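/- Optimal rate of convergence of the discrete eigenvalues: fix an integer k ≥ 1 and let λ_k be the k-th eigenvalue (in increasing order) of the clamped biharmonic operator on [0,1]. For each integer N ≥ k+1 (h = 1/N) let λ_{h,k} denote the k-th smallest eigenvalue of the inverse of the matrix K^h, i.e. λ_{h,k} = 1/μ_{h,k} where μ_{h,1} ≥ ⋯ ≥ μ_{h,N−1} are the eigenvalues of K^h in decreasing order. Then there exists a constant C > 0, depending only on k, such that |λ_k − λ_{h,k}| ≤ C·h⁴ for all N ≥ k+1. -/

import Mathlib

open Set

/-- `lam` is an eigenvalue of the clamped biharmonic operator on `[0,1]`. -/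
def IsClampedBiharmonicEV (lam : ℝ) : Prop :=
  ∃ φ : ℝ → ℝ, ContDiff ℝ 4 φ ∧ (∃ x ∈ Set.Icc (0:ℝ) 1, φ x ≠ 0) ∧
    (∀ x ∈ Set.Icc (0:ℝ) 1, iteratedDeriv 4 φ x = lam * φ x) ∧
    φ 0 = 0 ∧ deriv φ 0 = 0 ∧ φ 1 = 0 ∧ deriv φ 1 = 0

/-- Green's kernel of the clamped biharmonic operator on `[0,1]`. -/
noncomputable def Kgreen (x y : ℝ) : ℝ :=
  if y ≤ x then (1/6) * (1 - x)^2 * y^2 * (2*x*(1 - y) + x - y)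
  else (1/6) * x^2 * (1 - y)^2 * (2*y*(1 - x) + y - x)

/-- The `(N-1)×(N-1)` matrix `K^h` with entries `K^h_{i,j} = h·K(x_i, x_j)`, `h = 1/N`. -/
noncomputable def Kmat (N : ℕ) : Matrix (Fin (N-1)) (Fin (N-1)) ℝ :=
  fun i j => ((1:ℝ)/N) * Kgreen (((i : ℕ) + 1 : ℝ) / N) (((j : ℕ) + 1 : ℝ) / N)

/-- If the derivative of `E` vanishes to order `n` at `0` relative to the bound `B`, so does `E`. -/
lemma abs_le_of_hasDerivAt_abs_le {E E' : ℝ → ℝ} {h B : ℝ}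
    (hE : ∀ s ∈ Icc (0:ℝ) h, HasDerivAt E (E' s) s) (h0 : E 0 = 0)
    (hB : ∀ s ∈ Icc (0:ℝ) h, |E' s| ≤ B) : ∀ s ∈ Icc (0:ℝ) h, |E s| ≤ B * h := by
  intro s hs
  have hh : 0 ≤ h := hs.1.trans hs.2
  have h1 := (convex_Icc (0:ℝ) h).norm_image_sub_le_of_norm_hasDerivWithin_le
    (fun x hx => (hE x hx).hasDerivWithinAt) (fun x hx => hB x hx) ⟨le_rfl, hh⟩ hs
  rw [h0, sub_zero, sub_zero, Real.norm_eq_abs, Real.norm_eq_abs, abs_of_nonneg hs.1] at h1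
  have hB0 : 0 ≤ B := (abs_nonneg _).trans (hB 0 ⟨le_rfl, hh⟩)
  exact h1.trans (mul_le_mul_of_nonneg_left hs.2 hB0)

/-- One panel of the trapezoidal rule with endpoint correction. -/
lemma corrected_trapezoid {F f f1 f2 f3 f4 : ℝ → ℝ} {a h M : ℝ} (hh : 0 ≤ h)
    (hF : ∀ y ∈ Icc a (a + h), HasDerivAt F (f y) y)
    (hf : ∀ y, HasDerivAt f (f1 y) y) (hf1 : ∀ y, HasDerivAt f1 (f2 y) y)
    (hf2 : ∀ y, HasDerivAt f2 (f3 y) y) (hf3 : ∀ y, HasDerivAt f3 (f4 y) y)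
    (hM : ∀ y ∈ Icc a (a + h), |f4 y| ≤ M) :
    |F (a + h) - F a - h / 2 * (f a + f (a + h)) + h ^ 2 / 12 * (f1 (a + h) - f1 a)|
      ≤ M * h ^ 5 := by
  have hmem : ∀ s ∈ Icc (0:ℝ) h, a + s ∈ Icc a (a + h) := fun s hs =>
    ⟨by linarith [hs.1], by linarith [hs.2]⟩
  have shift : ∀ {g : ℝ → ℝ} {g' s : ℝ}, HasDerivAt g g' (a + s) →
      HasDerivAt (fun s => g (a + s)) g' s := fun hg => hg.comp_const_add a _
  have hM0 : 0 ≤ M := (abs_nonneg _).trans (hM a ⟨le_rfl, by linarith⟩)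
  have b3 : ∀ s ∈ Icc (0:ℝ) h, |s ^ 2 / 12 * f4 (a + s)| ≤ M * h ^ 2 := by
    intro s hs
    rw [abs_mul, abs_of_nonneg (by positivity)]
    have h1 := hM _ (hmem s hs)
    have h2 : s ^ 2 ≤ h ^ 2 := pow_le_pow_left₀ hs.1 hs.2 2
    calc s ^ 2 / 12 * |f4 (a + s)| ≤ h ^ 2 * M := by
          apply mul_le_mul _ h1 (abs_nonneg _) (by positivity)
          nlinarith [sq_nonneg s]
      _ = M * h ^ 2 := mul_comm _ _
  have b2 := abs_le_of_hasDerivAt_abs_le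
    (E := fun s => (f1 (a + s) - f1 a) / 6 - s / 6 * f2 (a + s) + s ^ 2 / 12 * f3 (a + s))
    (fun s _ => by
      have e := ((((shift (hf1 (a + s))).sub_const (f1 a)).div_const 6).sub
        (((hasDerivAt_id s).div_const 6).mul (shift (hf2 (a + s))))).add
        ((((hasDerivAt_id s).pow 2).div_const 12).mul (shift (hf3 (a + s))))
      refine e.congr_deriv ?_
      simp
      ring) (by simp) b3
  have b1 := abs_le_of_hasDerivAt_abs_le
    (E := fun s => (f (a + s) - f a) / 2 - s / 3 * f1 (a + s) - s / 6 * f1 a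
      + s ^ 2 / 12 * f2 (a + s))
    (fun s _ => by
      have e := (((((shift (hf (a + s))).sub_const (f a)).div_const 2).sub
        (((hasDerivAt_id s).div_const 3).mul (shift (hf1 (a + s))))).sub
        (((hasDerivAt_id s).div_const 6).mul_const (f1 a))).add
        ((((hasDerivAt_id s).pow 2).div_const 12).mul (shift (hf2 (a + s))))
      refine e.congr_deriv ?_
      simp
      ring) (by simp) b2
  have b0 := abs_le_of_hasDerivAt_abs_le
    (E := fun s => F (a + s) - F a - s / 2 * (f a + f (a + s))
      + s ^ 2 / 12 * (f1 (a + s) - f1 a))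
    (fun s hs => by
      have e := (((shift (hF (a + s) (hmem s hs))).sub_const (F a)).sub
        (((hasDerivAt_id s).div_const 2).mul ((shift (hf (a + s))).const_add (f a)))).add
        ((((hasDerivAt_id s).pow 2).div_const 12).mul ((shift (hf1 (a + s))).sub_const (f1 a)))
      refine e.congr_deriv ?_
      simp
      ring) (by simp) b1
  refine (b0 h ⟨hh, le_rfl⟩).trans (le_of_eq ?_)
  ring

/-- The composite trapezoidal rule with endpoint correction on the nodes `p/N, …, q/N`. -/
lemma corrected_trapezoid_sum {F f f1 f2 f3 f4 : ℝ → ℝ} {M : ℝ} {N p q : ℕ} (hN : 0 < N)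
    (hpq : p ≤ q) (hq : q ≤ N)
    (hF : ∀ y ∈ Icc (0:ℝ) 1, HasDerivAt F (f y) y)
    (hf : ∀ y, HasDerivAt f (f1 y) y) (hf1 : ∀ y, HasDerivAt f1 (f2 y) y)
    (hf2 : ∀ y, HasDerivAt f2 (f3 y) y) (hf3 : ∀ y, HasDerivAt f3 (f4 y) y)
    (hM : ∀ y ∈ Icc (0:ℝ) 1, |f4 y| ≤ M) :
    |F (q / N) - F (p / N)
        - (1 / N : ℝ) * (∑ j ∈ Finset.Ico p q, f (j / N) + (f (q / N) - f (p / N)) / 2)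
        + (1 / N : ℝ) ^ 2 / 12 * (f1 (q / N) - f1 (p / N))|
      ≤ M * (1 / N : ℝ) ^ 5 * (q - p) := by
  have hN' : (0:ℝ) < N := by exact_mod_cast hN
  induction q, hpq using Nat.le_induction with
  | base => simp
  | succ q hpq ih =>
    have ih := ih (by omega)
    have e1 : ((q + 1 : ℕ) : ℝ) / N = q / N + 1 / N := by push_cast; ring
    have hsub : Icc ((q:ℝ) / N) (q / N + 1 / N) ⊆ Icc (0:ℝ) 1 := by
      rw [← e1]
      apply Icc_subset_Icc (by positivity)
      rw [div_le_one hN']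
      exact_mod_cast hq
    have h1 := corrected_trapezoid (F := F) (a := (q:ℝ) / N) (h := 1 / N) (M := M)
      (by positivity) (fun y hy => hF y (hsub hy)) hf hf1 hf2 hf3 (fun y hy => hM y (hsub hy))
    rw [Finset.sum_Ico_succ_top hpq, e1]
    have h2 := (abs_add_le _ _).trans (add_le_add ih h1)
    refine le_trans (le_of_eq ?_) (h2.trans (le_of_eq ?_))
    · congr 1
      ring
    · push_cast
      ring

/-- Trapezoidal rule for a cubic polynomial times a solution of `φ⁗ = lam φ`, where an
antiderivative of the integrand is obtained from integration by parts. -/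
lemma cubic_mul_trapezoid {φ φ1 φ2 φ3 φ4 : ℝ → ℝ} {lam D c0 c1 c2 c3 : ℝ} {N p q : ℕ}
    (hlam : lam ≠ 0)
    (h0 : ∀ y, HasDerivAt φ (φ1 y) y) (h1 : ∀ y, HasDerivAt φ1 (φ2 y) y)
    (h2 : ∀ y, HasDerivAt φ2 (φ3 y) y) (h3 : ∀ y, HasDerivAt φ3 (φ4 y) y)
    (hode : ∀ y ∈ Icc (0:ℝ) 1, φ4 y = lam * φ y)
    (hD : ∀ y ∈ Icc (0:ℝ) 1, |φ1 y| ≤ D ∧ |φ2 y| ≤ D ∧ |φ3 y| ≤ D ∧ |φ4 y| ≤ D)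
    (hc0 : |c0| ≤ 1) (hc1 : |c1| ≤ 1) (hc2 : |c2| ≤ 1) (hc3 : |c3| ≤ 1)
    {k k1 k2 F f f1 : ℝ → ℝ}
    (hk : k = fun y => c0 + c1 * y + c2 * y ^ 2 + c3 * y ^ 3)
    (hk1 : k1 = fun y => c1 + 2 * c2 * y + 3 * c3 * y ^ 2)
    (hk2 : k2 = fun y => 2 * c2 + 6 * c3 * y)
    (hF : F = fun y => (k y * φ3 y - k1 y * φ2 y + k2 y * φ1 y - 6 * c3 * φ y) / lam)
    (hf : f = fun y => k y * φ y) (hf1 : f1 = fun y => k1 y * φ y + k y * φ1 y)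
    (hN : 0 < N) (hpq : p ≤ q) (hq : q ≤ N) :
    |F (q / N) - F (p / N)
        - (1 / N : ℝ) * (∑ j ∈ Finset.Ico p q, f (j / N) + (f (q / N) - f (p / N)) / 2)
        + (1 / N : ℝ) ^ 2 / 12 * (f1 (q / N) - f1 (p / N))|
      ≤ 100 * D * (1 / N : ℝ) ^ 5 * (q - p) := by
  have dk : ∀ y, HasDerivAt k (k1 y) y := fun y => by
    rw [hk, hk1]
    have e := (((hasDerivAt_const y c0).add ((hasDerivAt_id y).const_mul c1)).add
      (((hasDerivAt_id y).pow 2).const_mul c2)).add (((hasDerivAt_id y).pow 3).const_mul c3)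
    refine e.congr_deriv ?_
    simp
    ring
  have dk1 : ∀ y, HasDerivAt k1 (k2 y) y := fun y => by
    rw [hk1, hk2]
    have e := ((hasDerivAt_const y c1).add ((hasDerivAt_id y).const_mul (2 * c2))).add
      (((hasDerivAt_id y).pow 2).const_mul (3 * c3))
    refine e.congr_deriv ?_
    simp
    ring
  have dk2 : ∀ y, HasDerivAt k2 (6 * c3) y := fun y => by
    rw [hk2]
    have e := (hasDerivAt_const y (2 * c2)).add ((hasDerivAt_id y).const_mul (6 * c3))
    refine e.congr_deriv ?_
    simp
  have bk : ∀ y ∈ Icc (0:ℝ) 1, |k y| ≤ 4 ∧ |k1 y| ≤ 6 ∧ |k2 y| ≤ 8 := by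
    intro y hy
    have hy2 : y ^ 2 ∈ Icc (0:ℝ) 1 := ⟨by positivity, pow_le_one₀ hy.1 hy.2⟩
    have hy3 : y ^ 3 ∈ Icc (0:ℝ) 1 := ⟨pow_nonneg hy.1 3, pow_le_one₀ hy.1 hy.2⟩
    have key : ∀ {c z : ℝ}, |c| ≤ 1 → z ∈ Icc (0:ℝ) 1 → |c * z| ≤ 1 := by
      intro c z hc hz
      rw [abs_mul, abs_of_nonneg hz.1]
      exact mul_le_one₀ hc hz.1 hz.2
    have t1 := abs_le.1 (key hc1 hy)
    have t2 := abs_le.1 (key hc2 hy2)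
    have t3 := abs_le.1 (key hc3 hy3)
    have t4 := abs_le.1 (key hc2 hy)
    have t5 := abs_le.1 (key hc3 hy2)
    have t6 := abs_le.1 (key hc3 hy)
    have s0 := abs_le.1 hc0
    have s1 := abs_le.1 hc1
    have s2 := abs_le.1 hc2
    refine ⟨?_, ?_, ?_⟩ <;> rw [abs_le] <;> simp only [hk, hk1, hk2] <;> constructor <;> linarith
  refine corrected_trapezoid_sum (F := F) (f := f) (f1 := f1)
    (f2 := fun y => k2 y * φ y + 2 * (k1 y * φ1 y) + k y * φ2 y)
    (f3 := fun y => 6 * c3 * φ y + 3 * (k2 y * φ1 y) + 3 * (k1 y * φ2 y) + k y * φ3 y)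
    (f4 := fun y => 24 * c3 * φ1 y + 6 * (k2 y * φ2 y) + 4 * (k1 y * φ3 y) + k y * φ4 y)
    hN hpq hq ?_ ?_ ?_ ?_ ?_ ?_
  · intro y hy
    have e := (((((dk y).mul (h3 y)).sub ((dk1 y).mul (h2 y))).add ((dk2 y).mul (h1 y))).sub
      ((h0 y).const_mul (6 * c3))).div_const lam
    rw [hF, hf]
    refine e.congr_deriv ?_
    rw [hode y hy]
    field_simp
    ring
  · intro y
    rw [hf, hf1]
    exact (dk y).mul (h0 y)
  · intro y
    have e := ((dk1 y).mul (h0 y)).add ((dk y).mul (h1 y))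
    rw [hf1]
    refine e.congr_deriv ?_
    ring
  · intro y
    have e := (((dk2 y).mul (h0 y)).add (((dk1 y).mul (h1 y)).const_mul 2)).add
      ((dk y).mul (h2 y))
    refine e.congr_deriv ?_
    ring
  · intro y
    have e := ((((h0 y).const_mul (6 * c3)).add (((dk2 y).mul (h1 y)).const_mul 3)).add
      (((dk1 y).mul (h2 y)).const_mul 3)).add ((dk y).mul (h3 y))
    refine e.congr_deriv ?_
    ring
  · intro y hy
    obtain ⟨d1, d2, d3, d4⟩ := hD y hy
    obtain ⟨b0, b1, b2⟩ := bk y hy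
    have a1 : |24 * c3 * φ1 y| ≤ 24 * D := by
      rw [abs_mul, abs_mul, abs_of_pos (by norm_num : (0:ℝ) < 24)]
      have := mul_le_mul hc3 d1 (abs_nonneg _) zero_le_one
      linarith
    have a2 : |6 * (k2 y * φ2 y)| ≤ 48 * D := by
      rw [abs_mul, abs_mul, abs_of_pos (by norm_num : (0:ℝ) < 6)]
      have := mul_le_mul b2 d2 (abs_nonneg _) (by norm_num)
      linarith
    have a3 : |4 * (k1 y * φ3 y)| ≤ 24 * D := by
      rw [abs_mul, abs_mul, abs_of_pos (by norm_num : (0:ℝ) < 4)]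
      have := mul_le_mul b1 d3 (abs_nonneg _) (by norm_num)
      linarith
    have a4 : |k y * φ4 y| ≤ 4 * D := by
      rw [abs_mul]
      exact mul_le_mul b0 d4 (abs_nonneg _) (by norm_num)
    have t1 := abs_le.1 a1
    have t2 := abs_le.1 a2
    have t3 := abs_le.1 a3
    have t4 := abs_le.1 a4
    rw [abs_le]
    constructor <;> linarith

lemma clampedBiharmonic_nystrom_consistency {φ : ℝ → ℝ} {lam : ℝ} (hlam : lam ≠ 0)
    (hφ : ContDiff ℝ 4 φ) (hode : ∀ x ∈ Icc (0:ℝ) 1, iteratedDeriv 4 φ x = lam * φ x)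
    (hφ0 : φ 0 = 0) (hφ0' : deriv φ 0 = 0) (hφ1 : φ 1 = 0) (hφ1' : deriv φ 1 = 0) :
    ∃ C : ℝ, 0 < C ∧ ∀ N : ℕ, 0 < N → ∀ i ≤ N,
      |(1 / N : ℝ) * ∑ j ∈ Finset.range N, Kgreen (i / N) (j / N) * φ (j / N) - φ (i / N) / lam|
        ≤ C * (1 / N : ℝ) ^ 4 := by
  have hd : ∀ n < 4, ∀ y, HasDerivAt (iteratedDeriv n φ) (iteratedDeriv (n + 1) φ y) y := by
    intro n hn y
    rw [iteratedDeriv_succ]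
    exact ((hφ.differentiable_iteratedDeriv n (by exact_mod_cast hn)) y).hasDerivAt
  have h0 : ∀ y, HasDerivAt φ (iteratedDeriv 1 φ y) y := by
    simpa using hd 0 (by norm_num)
  have hb : ∀ n ≤ 4, ∃ D, ∀ y ∈ Icc (0:ℝ) 1, |iteratedDeriv n φ y| ≤ D := by
    intro n hn
    have hc : Continuous (iteratedDeriv n φ) := hφ.continuous_iteratedDeriv n (by exact_mod_cast hn)
    exact isCompact_Icc.exists_bound_of_continuousOn hc.continuousOn
  obtain ⟨D1, hD1⟩ := hb 1 (by norm_num)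
  obtain ⟨D2, hD2⟩ := hb 2 (by norm_num)
  obtain ⟨D3, hD3⟩ := hb 3 (by norm_num)
  obtain ⟨D4, hD4⟩ := hb 4 (by norm_num)
  have p1 : 0 ≤ D1 := (abs_nonneg _).trans (hD1 0 ⟨le_rfl, zero_le_one⟩)
  have p2 : 0 ≤ D2 := (abs_nonneg _).trans (hD2 0 ⟨le_rfl, zero_le_one⟩)
  have p3 : 0 ≤ D3 := (abs_nonneg _).trans (hD3 0 ⟨le_rfl, zero_le_one⟩)
  have p4 : 0 ≤ D4 := (abs_nonneg _).trans (hD4 0 ⟨le_rfl, zero_le_one⟩)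
  set D : ℝ := D1 + D2 + D3 + D4 + 1 with hDdef
  refine ⟨100 * D, by positivity, ?_⟩
  intro N hN i hi
  have hN' : (0:ℝ) < N := by exact_mod_cast hN
  have hD : ∀ y ∈ Icc (0:ℝ) 1, |iteratedDeriv 1 φ y| ≤ D ∧ |iteratedDeriv 2 φ y| ≤ D ∧
      |iteratedDeriv 3 φ y| ≤ D ∧ |iteratedDeriv 4 φ y| ≤ D := fun y hy =>
    ⟨(hD1 y hy).trans (by linarith), (hD2 y hy).trans (by linarith),
      (hD3 y hy).trans (by linarith), (hD4 y hy).trans (by linarith)⟩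
  set x : ℝ := (i:ℝ) / N with hx
  have hx0 : 0 ≤ x := by positivity
  have hx1 : x ≤ 1 := by
    rw [hx, div_le_one hN']
    exact_mod_cast hi
  have hx2 : x ^ 2 ≤ 1 := pow_le_one₀ hx0 hx1
  have hx2' : 0 ≤ x ^ 2 := sq_nonneg x
  have hx3 : x ^ 3 ≤ 1 := pow_le_one₀ hx0 hx1
  have hx3' : 0 ≤ x ^ 3 := pow_nonneg hx0 3
  have L := cubic_mul_trapezoid (N := N) (p := 0) (q := i) (D := D) (c0 := 0) (c1 := 0)
    (c2 := (1 - x) ^ 2 * x / 2) (c3 := -((1 - x) ^ 2 * (2 * x + 1)) / 6)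
    hlam h0 (hd 1 (by norm_num)) (hd 2 (by norm_num)) (hd 3 (by norm_num)) hode hD
    (by simp) (by simp) (by rw [abs_le]; constructor <;> nlinarith)
    (by rw [abs_le]; constructor <;> nlinarith) rfl rfl rfl rfl rfl rfl hN (Nat.zero_le _) hi
  have R := cubic_mul_trapezoid (N := N) (p := i) (q := N) (D := D) (c0 := -x ^ 3 / 6)
    (c1 := x ^ 2 / 2) (c2 := x ^ 2 * (3 * x - 6) / 6) (c3 := x ^ 2 * (3 - 2 * x) / 6)
    hlam h0 (hd 1 (by norm_num)) (hd 2 (by norm_num)) (hd 3 (by norm_num)) hode hD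
    (by rw [abs_le]; constructor <;> linarith) (by rw [abs_le]; constructor <;> linarith)
    (by rw [abs_le]; constructor <;> nlinarith)
    (by rw [abs_le]; constructor <;> nlinarith) rfl rfl rfl rfl rfl rfl hN hi le_rfl
  have hsL : ∑ j ∈ Finset.Ico 0 i, (0 + 0 * ((j:ℝ) / N) + (1 - x) ^ 2 * x / 2 * ((j:ℝ) / N) ^ 2
      + -((1 - x) ^ 2 * (2 * x + 1)) / 6 * ((j:ℝ) / N) ^ 3) * φ (j / N)
      = ∑ j ∈ Finset.Ico 0 i, Kgreen x (j / N) * φ (j / N) := by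
    refine Finset.sum_congr rfl fun j hj => ?_
    have hj' : (j:ℝ) / N ≤ x := by
      rw [hx]
      gcongr
      exact (Finset.mem_Ico.1 hj).2.le
    rw [Kgreen, if_pos hj']
    ring
  have hsR : ∑ j ∈ Finset.Ico i N, (-x ^ 3 / 6 + x ^ 2 / 2 * ((j:ℝ) / N)
      + x ^ 2 * (3 * x - 6) / 6 * ((j:ℝ) / N) ^ 2
      + x ^ 2 * (3 - 2 * x) / 6 * ((j:ℝ) / N) ^ 3) * φ (j / N)
      = ∑ j ∈ Finset.Ico i N, Kgreen x (j / N) * φ (j / N) := by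
    refine Finset.sum_congr rfl fun j hj => ?_
    have hj' : x ≤ (j:ℝ) / N := by
      rw [hx]
      gcongr
      exact (Finset.mem_Ico.1 hj).1
    rcases hj'.eq_or_lt with h | h
    · rw [Kgreen, if_pos h.ge, ← h]
      ring
    · rw [Kgreen, if_neg (not_le.2 h)]
      ring
  have hsum := Finset.sum_Ico_consecutive (fun j : ℕ => Kgreen x (j / N) * φ (j / N))
    (Nat.zero_le i) hi
  rw [← Finset.range_eq_Ico N] at hsum
  have hφ0'' : iteratedDeriv 1 φ 0 = 0 := by rw [iteratedDeriv_one, hφ0']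
  have hφ1'' : iteratedDeriv 1 φ 1 = 0 := by rw [iteratedDeriv_one, hφ1']
  simp only [hsL] at L
  simp only [hsR] at R
  have h00 : ((0:ℕ):ℝ) / N = 0 := by simp
  have hNN : (N:ℝ) / N = 1 := div_self hN'.ne'
  rw [h00] at L
  rw [hNN] at R
  rw [← hx] at L R
  simp only [hφ0, hφ0''] at L
  simp only [hφ1, hφ1''] at R
  rw [← hsum]
  rw [abs_sub_comm]
  refine le_trans (le_of_eq ?_) (((abs_add_le _ _).trans (add_le_add L R)).trans (le_of_eq ?_))
  · congr 1
    field_simp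
    ring
  · push_cast
    field_simp
    ring

lemma Kgreen_eq (x y : ℝ) : Kgreen x y =
    x ^ 2 * (y * (1 - y) ^ 2 / 2) - x ^ 3 * ((1 - y) ^ 2 * (2 * y + 1) / 6)
      + (max (x - y) 0) ^ 3 / 6 := by
  unfold Kgreen
  split_ifs with h
  · rw [max_eq_left (by linarith)]
    ring
  · rw [max_eq_right (by linarith)]
    ring

lemma Kgreen_zero_left {y : ℝ} (hy : 0 ≤ y) : Kgreen 0 y = 0 := by
  rw [Kgreen_eq, max_eq_right (by linarith)]
  ring

lemma continuous_Kgreen : Continuous fun p : ℝ × ℝ => Kgreen p.1 p.2 := by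
  simp only [Kgreen_eq]
  fun_prop

lemma abs_Kgreen_sub_le {x x' y : ℝ} (hx : x ∈ Icc (0:ℝ) 1) (hx' : x' ∈ Icc (0:ℝ) 1)
    (hy : y ∈ Icc (0:ℝ) 1) : |Kgreen x y - Kgreen x' y| ≤ 2 * |x - x'| := by
  have sq : ∀ {a b : ℝ}, a ∈ Icc (0:ℝ) 1 → b ∈ Icc (0:ℝ) 1 → |a ^ 2 - b ^ 2| ≤ 2 * |a - b| := by
    intro a b ha hb
    rw [show a ^ 2 - b ^ 2 = (a + b) * (a - b) by ring, abs_mul,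
      abs_of_nonneg (add_nonneg ha.1 hb.1)]
    exact mul_le_mul_of_nonneg_right (by linarith [ha.2, hb.2]) (abs_nonneg _)
  have cube : ∀ {a b : ℝ}, a ∈ Icc (0:ℝ) 1 → b ∈ Icc (0:ℝ) 1 →
      |a ^ 3 - b ^ 3| ≤ 3 * |a - b| := by
    intro a b ha hb
    have h1 : 0 ≤ a ^ 2 + a * b + b ^ 2 := by
      nlinarith [mul_nonneg ha.1 hb.1, sq_nonneg a, sq_nonneg b]
    have h2 : a ^ 2 + a * b + b ^ 2 ≤ 3 := by
      nlinarith [mul_nonneg ha.1 hb.1, ha.1, ha.2, hb.1, hb.2]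
    rw [show a ^ 3 - b ^ 3 = (a ^ 2 + a * b + b ^ 2) * (a - b) by ring, abs_mul,
      abs_of_nonneg h1]
    exact mul_le_mul_of_nonneg_right h2 (abs_nonneg _)
  have hp : ∀ {a : ℝ}, a ∈ Icc (0:ℝ) 1 → max (a - y) 0 ∈ Icc (0:ℝ) 1 := fun ha =>
    ⟨le_max_right _ _, max_le (by linarith [ha.2, hy.1]) zero_le_one⟩
  have e1 := sq hx hx'
  have e2 := cube hx hx'
  have e3 := cube (hp hx) (hp hx')
  have e4 : |max (x - y) 0 - max (x' - y) 0| ≤ |x - x'| := by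
    have := abs_max_sub_max_le_abs (x - y) (x' - y) 0
    rwa [sub_sub_sub_cancel_right] at this
  have ha0 : 0 ≤ y * (1 - y) ^ 2 / 2 := by
    have := hy.1
    positivity
  have ha1 : y * (1 - y) ^ 2 / 2 ≤ 1 / 2 := by
    have := mul_le_one₀ hy.2 (sq_nonneg (1 - y))
      (pow_le_one₀ (by linarith [hy.2]) (by linarith [hy.1]))
    linarith
  have hb0 : 0 ≤ (1 - y) ^ 2 * (2 * y + 1) / 6 := by
    have := hy.1
    positivity
  have hb1 : (1 - y) ^ 2 * (2 * y + 1) / 6 ≤ 1 / 6 := by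
    nlinarith [hy.1, hy.2, mul_nonneg (mul_nonneg hy.1 hy.1) (sub_nonneg.2 hy.2)]
  have t1 : |(x ^ 2 - x' ^ 2) * (y * (1 - y) ^ 2 / 2)| ≤ |x - x'| := by
    rw [abs_mul, abs_of_nonneg ha0]
    have := mul_le_mul e1 ha1 ha0 (by positivity)
    linarith
  have t2 : |(x ^ 3 - x' ^ 3) * ((1 - y) ^ 2 * (2 * y + 1) / 6)| ≤ |x - x'| / 2 := by
    rw [abs_mul, abs_of_nonneg hb0]
    have := mul_le_mul e2 hb1 hb0 (by positivity)
    linarith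
  rw [Kgreen_eq, Kgreen_eq]
  have s1 := abs_le.1 t1
  have s2 := abs_le.1 t2
  have s3 := abs_le.1 e3
  rw [abs_le]
  constructor <;> nlinarith

lemma abs_Kgreen_le {x y : ℝ} (hx : x ∈ Icc (0:ℝ) 1) (hy : y ∈ Icc (0:ℝ) 1) :
    |Kgreen x y| ≤ 2 := by
  have h := abs_Kgreen_sub_le hx ⟨le_rfl, zero_le_one⟩ hy
  rw [Kgreen_zero_left hy.1, sub_zero, sub_zero, abs_of_nonneg hx.1] at h
  linarith [hx.2]

/-- A continuous solution of the integral equation `m g = ∫ K g` solves the clamped problem. -/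
lemma exists_clamped_chain {g : ℝ → ℝ} {m : ℝ} (hm : m ≠ 0) (hg : Continuous g)
    (heq : ∀ x ∈ Icc (0:ℝ) 1, m * g x = ∫ y in (0:ℝ)..1, Kgreen x y * g y) :
    ∃ φ φ1 φ2 φ3 : ℝ → ℝ, (∀ x, HasDerivAt φ (φ1 x) x) ∧ (∀ x, HasDerivAt φ1 (φ2 x) x) ∧
      (∀ x, HasDerivAt φ2 (φ3 x) x) ∧ (∀ x, HasDerivAt φ3 (g x / m) x) ∧
      (∀ x ∈ Icc (0:ℝ) 1, φ x = g x) ∧ φ 0 = 0 ∧ φ1 0 = 0 ∧ φ 1 = 0 ∧ φ1 1 = 0 ∧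
      φ2 0 = (∫ y in (0:ℝ)..1, y * (1 - y) ^ 2 * g y) / m := by
  have ii : ∀ {f : ℝ → ℝ} (a b : ℝ), Continuous f →
      IntervalIntegrable f MeasureTheory.volume a b := fun a b hf => hf.intervalIntegrable a b
  have hG : ∀ {f : ℝ → ℝ}, Continuous f → ∀ x, HasDerivAt (fun x => ∫ y in (0:ℝ)..x, f y) (f x) x :=
    fun hf x => intervalIntegral.integral_hasDerivAt_right (ii 0 x hf)
      (hf.stronglyMeasurableAtFilter _ _) hf.continuousAt
  set A : ℝ := ∫ y in (0:ℝ)..1, y * (1 - y) ^ 2 * g y with hA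
  set B : ℝ := ∫ y in (0:ℝ)..1, (1 - y) ^ 2 * (2 * y + 1) * g y with hB
  set G0 : ℝ → ℝ := fun x => ∫ y in (0:ℝ)..x, g y with hG0
  set G1 : ℝ → ℝ := fun x => ∫ y in (0:ℝ)..x, y * g y with hG1
  set G2 : ℝ → ℝ := fun x => ∫ y in (0:ℝ)..x, y ^ 2 * g y with hG2
  set G3 : ℝ → ℝ := fun x => ∫ y in (0:ℝ)..x, y ^ 3 * g y with hG3
  have d0 : ∀ x, HasDerivAt G0 (g x) x := hG hg
  have d1 : ∀ x, HasDerivAt G1 (x * g x) x := hG (f := fun y => y * g y) (by fun_prop)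
  have d2 : ∀ x, HasDerivAt G2 (x ^ 2 * g x) x := hG (f := fun y => y ^ 2 * g y) (by fun_prop)
  have d3 : ∀ x, HasDerivAt G3 (x ^ 3 * g x) x := hG (f := fun y => y ^ 3 * g y) (by fun_prop)
  have z0 : G0 0 = 0 := intervalIntegral.integral_same
  have z1 : G1 0 = 0 := intervalIntegral.integral_same
  have z2 : G2 0 = 0 := intervalIntegral.integral_same
  have z3 : G3 0 = 0 := intervalIntegral.integral_same
  have poly : ∀ (c0 c1 c2 c3 : ℝ) (x : ℝ),
      ∫ y in (0:ℝ)..x, (c0 + c1 * y + c2 * y ^ 2 + c3 * y ^ 3) * g y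
        = c0 * G0 x + c1 * G1 x + c2 * G2 x + c3 * G3 x := by
    intro c0 c1 c2 c3 x
    simp only [hG0, hG1, hG2, hG3, ← intervalIntegral.integral_const_mul]
    rw [← intervalIntegral.integral_add, ← intervalIntegral.integral_add,
      ← intervalIntegral.integral_add]
    · exact intervalIntegral.integral_congr fun y _ => by ring
    all_goals exact ii _ _ (by fun_prop)
  have hA' : A = G1 1 - 2 * G2 1 + G3 1 := by
    have := poly 0 1 (-2) 1 1
    rw [hA]
    convert this using 1
    · exact intervalIntegral.integral_congr fun y _ => by ring
    · ring
  have hB' : B = G0 1 - 3 * G2 1 + 2 * G3 1 := by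
    have := poly 1 0 (-3) 2 1
    rw [hB]
    convert this using 1
    · exact intervalIntegral.integral_congr fun y _ => by ring
    · ring
  have hpart : ∀ x ∈ Icc (0:ℝ) 1, ∫ y in (0:ℝ)..1, (max (x - y) 0) ^ 3 / 6 * g y
      = (x ^ 3 * G0 x - 3 * x ^ 2 * G1 x + 3 * x * G2 x - G3 x) / 6 := by
    intro x hx
    rw [← intervalIntegral.integral_add_adjacent_intervals (b := x)
      (ii _ _ (by fun_prop)) (ii _ _ (by fun_prop))]
    have e1 : ∫ y in (0:ℝ)..x, (max (x - y) 0) ^ 3 / 6 * g y = ∫ y in (0:ℝ)..x,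
        (x ^ 3 / 6 + (-x ^ 2 / 2) * y + (x / 2) * y ^ 2 + (-1 / 6) * y ^ 3) * g y := by
      refine intervalIntegral.integral_congr fun y hy => ?_
      rw [uIcc_of_le hx.1] at hy
      rw [max_eq_left (by linarith [hy.2])]
      ring
    have e2 : ∫ y in x..1, (max (x - y) 0) ^ 3 / 6 * g y = 0 := by
      rw [intervalIntegral.integral_congr (g := fun _ => (0:ℝ)), intervalIntegral.integral_zero]
      intro y hy
      rw [uIcc_of_le hx.2] at hy
      beta_reduce
      rw [max_eq_right (by linarith [hy.1])]
      ring
    rw [e1, e2, poly]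
    ring
  have hint : ∀ x ∈ Icc (0:ℝ) 1, m * g x = x ^ 2 * A / 2 - x ^ 3 * B / 6
      + (x ^ 3 * G0 x - 3 * x ^ 2 * G1 x + 3 * x * G2 x - G3 x) / 6 := by
    intro x hx
    rw [heq x hx, ← hpart x hx, hA, hB]
    have e : ∫ y in (0:ℝ)..1, Kgreen x y * g y = ∫ y in (0:ℝ)..1,
        (x ^ 2 / 2 * (y * (1 - y) ^ 2 * g y) - x ^ 3 / 6 * ((1 - y) ^ 2 * (2 * y + 1) * g y)
          + (max (x - y) 0) ^ 3 / 6 * g y) := by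
      refine intervalIntegral.integral_congr fun y _ => ?_
      simp only [Kgreen_eq]
      ring
    rw [e, intervalIntegral.integral_add (ii _ _ (by fun_prop)) (ii _ _ (by fun_prop)),
      intervalIntegral.integral_sub (ii _ _ (by fun_prop)) (ii _ _ (by fun_prop)),
      intervalIntegral.integral_const_mul, intervalIntegral.integral_const_mul]
    ring
  have hval : ∀ x ∈ Icc (0:ℝ) 1, (x ^ 2 * A / 2 - x ^ 3 * B / 6
      + (x ^ 3 * G0 x - 3 * x ^ 2 * G1 x + 3 * x * G2 x - G3 x) / 6) / m = g x := by
    intro x hx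
    rw [← hint x hx, mul_div_cancel_left₀ _ hm]
  refine ⟨fun x => (x ^ 2 * A / 2 - x ^ 3 * B / 6
      + (x ^ 3 * G0 x - 3 * x ^ 2 * G1 x + 3 * x * G2 x - G3 x) / 6) / m,
    fun x => (x * A - x ^ 2 * B / 2 + (x ^ 2 * G0 x - 2 * x * G1 x + G2 x) / 2) / m,
    fun x => (A - x * B + (x * G0 x - G1 x)) / m,
    fun x => (-B + G0 x) / m, ?_, ?_, ?_, ?_, hval, ?_, ?_, ?_, ?_, ?_⟩
  · intro x
    have i1 := hasDerivAt_id x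
    have e := (((((i1.pow 2).mul_const A).div_const 2).sub
      (((i1.pow 3).mul_const B).div_const 6)).add
      ((((((i1.pow 3).mul (d0 x)).sub (((i1.pow 2).const_mul 3).mul (d1 x))).add
        ((i1.const_mul 3).mul (d2 x))).sub (d3 x)).div_const 6)).div_const m
    refine e.congr_deriv ?_
    simp
    field_simp
    ring
  · intro x
    have i1 := hasDerivAt_id x
    have e := (((i1.mul_const A).sub (((i1.pow 2).mul_const B).div_const 2)).add
      (((((i1.pow 2).mul (d0 x)).sub ((i1.const_mul 2).mul (d1 x))).add (d2 x)).div_const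
        2)).div_const m
    refine e.congr_deriv ?_
    simp
    field_simp
    ring
  · intro x
    have i1 := hasDerivAt_id x
    have e := (((i1.mul_const B).const_sub A).add ((i1.mul (d0 x)).sub (d1 x))).div_const m
    refine e.congr_deriv ?_
    simp
  · intro x
    exact ((d0 x).const_add (-B)).div_const m
  · simp [z3]
  · simp [z2]
  · simp only [hA', hB']
    ring
  · simp only [hA', hB']
    ring
  · simp [z1]

lemma isClampedBiharmonicEV_of_integral_eq {g : ℝ → ℝ} {m : ℝ} (hm : m ≠ 0) (hg : Continuous g)
    (heq : ∀ x ∈ Icc (0:ℝ) 1, m * g x = ∫ y in (0:ℝ)..1, Kgreen x y * g y)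
    (hne : ∃ x ∈ Icc (0:ℝ) 1, g x ≠ 0) : IsClampedBiharmonicEV m⁻¹ := by
  obtain ⟨φ, φ1, φ2, φ3, h0, h1, h2, h3, hval, a0, a1, b0, b1, -⟩ :=
    exists_clamped_chain hm hg heq
  have e1 : deriv φ = φ1 := funext fun x => (h0 x).deriv
  have e2 : deriv φ1 = φ2 := funext fun x => (h1 x).deriv
  have e3 : deriv φ2 = φ3 := funext fun x => (h2 x).deriv
  have e4 : deriv φ3 = fun x => g x / m := funext fun x => (h3 x).deriv
  have it : iteratedDeriv 4 φ = fun x => g x / m := by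
    rw [iteratedDeriv_succ', e1, iteratedDeriv_succ', e2, iteratedDeriv_succ', e3,
      iteratedDeriv_one, e4]
  have step : ∀ {f f' : ℝ → ℝ} {n : ℕ}, (∀ x, HasDerivAt f (f' x) x) → ContDiff ℝ n f' →
      ContDiff ℝ ((n : ℕ) + 1) f := by
    intro f f' n hf hf'
    rw [contDiff_succ_iff_deriv]
    refine ⟨fun x => (hf x).differentiableAt, by simp, ?_⟩
    rwa [funext fun x => (hf x).deriv]
  have c0 : ContDiff ℝ ((0 : ℕ) : WithTop ℕ∞) fun x => g x / m := by
    exact_mod_cast contDiff_zero.2 (hg.div_const m)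
  have c1 := step (n := 0) h3 c0
  have c2 := step (n := 1) h2 (by exact_mod_cast c1)
  have c3 := step (n := 2) h1 (by exact_mod_cast c2)
  have c4 := step (n := 3) h0 (by exact_mod_cast c3)
  obtain ⟨x, hx, hxne⟩ := hne
  refine ⟨φ, by exact_mod_cast c4, ⟨x, hx, by rwa [hval x hx]⟩, fun y hy => ?_, a0,
    by rw [e1, a1], b0, by rw [e1, b1]⟩
  rw [it, hval y hy]
  simp only
  rw [div_eq_inv_mul]

/-- A clamped solution of `φ⁗ = lam φ` whose second derivative vanishes at `0` is zero
(Pohozaev multiplier). -/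
lemma clamped_chain_eq_zero {φ φ1 φ2 φ3 φ4 : ℝ → ℝ} {lam : ℝ} (hlam : 0 < lam)
    (h0 : ∀ x, HasDerivAt φ (φ1 x) x) (h1 : ∀ x, HasDerivAt φ1 (φ2 x) x)
    (h2 : ∀ x, HasDerivAt φ2 (φ3 x) x) (h3 : ∀ x, HasDerivAt φ3 (φ4 x) x)
    (hode : ∀ x ∈ Icc (0:ℝ) 1, φ4 x = lam * φ x)
    (a0 : φ 0 = 0) (a1 : φ1 0 = 0) (b0 : φ 1 = 0) (b1 : φ1 1 = 0) (a2 : φ2 0 = 0) :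
    ∀ x ∈ Icc (0:ℝ) 1, φ x = 0 := by
  set G : ℝ → ℝ := fun x => (1 - x) * (φ1 x * φ3 x) - (1 - x) * (φ2 x) ^ 2 / 2
    - lam * ((1 - x) * (φ x) ^ 2) / 2 + 3 / 2 * (φ x * φ3 x) - φ1 x * φ2 x / 2 with hG
  have dG : ∀ x ∈ Icc (0:ℝ) 1, HasDerivAt G (2 * lam * (φ x) ^ 2) x := by
    intro x hx
    have i1 := (hasDerivAt_id x).const_sub 1
    have e := ((((i1.mul ((h1 x).mul (h3 x))).sub ((i1.mul ((h2 x).pow 2)).div_const 2)).sub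
      (((i1.mul ((h0 x).pow 2)).const_mul lam).div_const 2)).add
      (((h0 x).mul (h3 x)).const_mul (3 / 2))).sub (((h1 x).mul (h2 x)).div_const 2)
    refine e.congr_deriv ?_
    simp
    rw [hode x hx]
    ring
  have hmono : MonotoneOn G (Icc (0:ℝ) 1) := by
    refine monotoneOn_of_deriv_nonneg (convex_Icc 0 1)
      (fun x hx => (dG x hx).continuousAt.continuousWithinAt) ?_ ?_
    · rw [interior_Icc]
      exact fun x hx => (dG x (Ioo_subset_Icc_self hx)).differentiableAt.differentiableWithinAt
    · rw [interior_Icc]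
      intro x hx
      rw [(dG x (Ioo_subset_Icc_self hx)).deriv]
      positivity
  have G0 : G 0 = 0 := by simp [hG, a0, a1, a2]
  have G1 : G 1 = 0 := by simp [hG, b0, b1]
  have hzero : ∀ x ∈ Icc (0:ℝ) 1, G x = 0 := fun x hx => le_antisymm
    (G1 ▸ hmono hx ⟨zero_le_one, le_rfl⟩ hx.2) (G0 ▸ hmono ⟨le_rfl, zero_le_one⟩ hx hx.1)
  intro x hx
  rcases hx.1.eq_or_lt with rfl | hx0
  · exact a0
  rcases hx.2.eq_or_lt with rfl | hx1
  · exact b0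
  have hev : G =ᶠ[nhds x] fun _ => 0 := by
    filter_upwards [Ioo_mem_nhds hx0 hx1] with y hy
    exact hzero y (Ioo_subset_Icc_self hy)
  have h := (dG x hx).unique ((hasDerivAt_const x (0:ℝ)).congr_of_eventuallyEq hev)
  have h' : (φ x) ^ 2 = 0 := by
    rcases mul_eq_zero.1 h with h | h
    · linarith
    · exact h
  exact pow_eq_zero_iff (two_ne_zero) |>.1 h'

lemma eq_zero_of_integral_eq {g : ℝ → ℝ} {m : ℝ} (hm : 0 < m) (hg : Continuous g)
    (heq : ∀ x ∈ Icc (0:ℝ) 1, m * g x = ∫ y in (0:ℝ)..1, Kgreen x y * g y)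
    (h2 : ∫ y in (0:ℝ)..1, y * (1 - y) ^ 2 * g y = 0) : ∀ x ∈ Icc (0:ℝ) 1, g x = 0 := by
  obtain ⟨φ, φ1, φ2, φ3, d0, d1, d2, d3, hval, a0, a1, b0, b1, a2⟩ :=
    exists_clamped_chain hm.ne' hg heq
  intro x hx
  rw [← hval x hx]
  refine clamped_chain_eq_zero (lam := m⁻¹) (inv_pos.2 hm) d0 d1 d2 d3 ?_ a0 a1 b0 b1
    (by rw [a2, h2, zero_div]) x hx
  intro y hy
  rw [hval y hy, div_eq_inv_mul]

/-- Eigenspaces of the integral operator with kernel `Kgreen` are one-dimensional. -/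
lemma integral_eq_simple {u w : ℝ → ℝ} {m : ℝ} (hm : 0 < m) (hu : Continuous u)
    (hw : Continuous w)
    (hequ : ∀ x ∈ Icc (0:ℝ) 1, m * u x = ∫ y in (0:ℝ)..1, Kgreen x y * u y)
    (heqw : ∀ x ∈ Icc (0:ℝ) 1, m * w x = ∫ y in (0:ℝ)..1, Kgreen x y * w y)
    (hu1 : ∫ y in (0:ℝ)..1, u y ^ 2 = 1) (hw1 : ∫ y in (0:ℝ)..1, w y ^ 2 = 1) :
    ∫ y in (0:ℝ)..1, u y * w y ≠ 0 := by
  intro huw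
  have ii : ∀ {f : ℝ → ℝ}, Continuous f →
      IntervalIntegrable f MeasureTheory.volume 0 1 := fun hf => hf.intervalIntegrable _ _
  set a : ℝ := ∫ y in (0:ℝ)..1, y * (1 - y) ^ 2 * u y with ha
  set b : ℝ := ∫ y in (0:ℝ)..1, y * (1 - y) ^ 2 * w y with hb
  have hcK : ∀ x, Continuous fun y => Kgreen x y := fun x =>
    continuous_Kgreen.comp (by fun_prop : Continuous fun y : ℝ => (x, y))
  have hz := eq_zero_of_integral_eq (g := fun x => a * w x - b * u x) hm (by fun_prop)
    (fun x hx => by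
      have hK := hcK x
      have e : ∫ y in (0:ℝ)..1, Kgreen x y * (a * w y - b * u y)
          = ∫ y in (0:ℝ)..1, (a * (Kgreen x y * w y) - b * (Kgreen x y * u y)) :=
        intervalIntegral.integral_congr fun y _ => by ring
      rw [e, intervalIntegral.integral_sub (ii (by fun_prop)) (ii (by fun_prop)),
        intervalIntegral.integral_const_mul, intervalIntegral.integral_const_mul,
        ← hequ x hx, ← heqw x hx]
      ring)
    (by
      have e : ∫ y in (0:ℝ)..1, y * (1 - y) ^ 2 * (a * w y - b * u y)
          = ∫ y in (0:ℝ)..1, (a * (y * (1 - y) ^ 2 * w y) - b * (y * (1 - y) ^ 2 * u y)) :=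
        intervalIntegral.integral_congr fun y _ => by ring
      rw [e, intervalIntegral.integral_sub (ii (by fun_prop)) (ii (by fun_prop)),
        intervalIntegral.integral_const_mul, intervalIntegral.integral_const_mul,
        ← ha, ← hb]
      ring)
  have hb0 : b = 0 := by
    have e : ∫ y in (0:ℝ)..1, (a * (u y * w y) - b * u y ^ 2) = 0 := by
      rw [intervalIntegral.integral_congr (g := fun _ => (0:ℝ)), intervalIntegral.integral_zero]
      intro y hy
      rw [uIcc_of_le zero_le_one] at hy
      have := hz y hy
      simp only at this ⊢
      linear_combination u y * this
    rw [intervalIntegral.integral_sub (ii (by fun_prop)) (ii (by fun_prop)),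
      intervalIntegral.integral_const_mul, intervalIntegral.integral_const_mul, huw, hu1] at e
    linarith
  have hw0 := eq_zero_of_integral_eq hm hw heqw hb0
  have : ∫ y in (0:ℝ)..1, w y ^ 2 = 0 := by
    rw [intervalIntegral.integral_congr (g := fun _ => (0:ℝ)), intervalIntegral.integral_zero]
    intro y hy
    rw [uIcc_of_le zero_le_one] at hy
    simp [hw0 y hy]
  rw [this] at hw1
  exact zero_ne_one hw1

open Filter Topology in
lemma TendstoUniformlyOn.real_mul_of_bounded {ι α : Type*} {l : Filter ι} {s : Set α}
    {F G : ι → α → ℝ} {f g : α → ℝ} {M : ℝ} (hF : TendstoUniformlyOn F f l s)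
    (hG : TendstoUniformlyOn G g l s) (hFM : ∀ n, ∀ x ∈ s, |F n x| ≤ M)
    (hgM : ∀ x ∈ s, |g x| ≤ M) :
    TendstoUniformlyOn (fun n x => F n x * G n x) (fun x => f x * g x) l s := by
  rw [Metric.tendstoUniformlyOn_iff] at hF hG ⊢
  intro ε hε
  have hM : 0 < 2 * (|M| + 1) := by positivity
  filter_upwards [hF (ε / (2 * (|M| + 1))) (by positivity),
    hG (ε / (2 * (|M| + 1))) (by positivity)] with n h1 h2 x hx
  have h1 := h1 x hx
  have h2 := h2 x hx
  rw [Real.dist_eq] at h1 h2 ⊢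
  have b1 : |F n x| < |M| + 1 := by linarith [hFM n x hx, le_abs_self M]
  have b2 : |g x| < |M| + 1 := by linarith [hgM x hx, le_abs_self M]
  calc |f x * g x - F n x * G n x| = |(f x - F n x) * g x + F n x * (g x - G n x)| := by
        congr 1
        ring
    _ ≤ |f x - F n x| * |g x| + |F n x| * |g x - G n x| := by
        refine (abs_add_le _ _).trans ?_
        rw [abs_mul, abs_mul]
    _ < ε / (2 * (|M| + 1)) * (|M| + 1) + (|M| + 1) * (ε / (2 * (|M| + 1))) :=
        add_lt_add (mul_lt_mul'' h1 b2 (abs_nonneg _) (abs_nonneg _))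
          (mul_lt_mul'' b1 h2 (abs_nonneg _) (abs_nonneg _))
    _ = ε := by
        field_simp
        ring

lemma natCast_div_mem_Icc {j N : ℕ} (h : j ≤ N) : (j:ℝ) / N ∈ Icc (0:ℝ) 1 :=
  ⟨by positivity, div_le_one_of_le₀ (by exact_mod_cast h) (Nat.cast_nonneg _)⟩

/-- Error of the left Riemann sum in terms of the oscillation on the mesh scale. -/
lemma abs_integral_sub_riemann_le {f : ℝ → ℝ} (hf : Continuous f) {N : ℕ} (hN : 0 < N) {ε : ℝ}
    (h : ∀ x ∈ Icc (0:ℝ) 1, ∀ y ∈ Icc (0:ℝ) 1, |x - y| ≤ 1 / N → |f x - f y| ≤ ε) :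
    |(∫ y in (0:ℝ)..1, f y) - (1 / N : ℝ) * ∑ j ∈ Finset.range N, f (j / N)| ≤ ε := by
  have hN' : (0:ℝ) < N := by exact_mod_cast hN
  have ii : ∀ a b : ℝ, IntervalIntegrable f MeasureTheory.volume a b :=
    fun a b => hf.intervalIntegrable a b
  have key : ∀ n ≤ N, |(∫ y in (0:ℝ)..((n:ℝ) / N), f y)
      - (1 / N : ℝ) * ∑ j ∈ Finset.range n, f (j / N)| ≤ ε * (n / N) := by
    intro n
    induction n with
    | zero => simp
    | succ n ih =>
      intro hn
      have ih := ih (by omega)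
      have e1 : ((n + 1 : ℕ) : ℝ) / N = n / N + 1 / N := by push_cast; ring
      have hle : (n:ℝ) / N ≤ ((n + 1 : ℕ) : ℝ) / N := by
        rw [e1]
        linarith [show (0:ℝ) < 1 / N by positivity]
      have e2 := intervalIntegral.norm_integral_le_of_norm_le_const
        (f := fun y => f y - f (n / N)) (a := (n:ℝ) / N) (b := ((n + 1 : ℕ) : ℝ) / N) (C := ε)
        (fun y hy => by
          rw [uIoc_of_le hle] at hy
          refine h y ⟨?_, ?_⟩ _ (natCast_div_mem_Icc (by omega)) ?_
          · exact (by positivity : (0:ℝ) ≤ n / N).trans hy.1.le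
          · exact hy.2.trans (natCast_div_mem_Icc hn).2
          · rw [abs_of_nonneg (by linarith [hy.1])]
            linarith [hy.2])
      rw [intervalIntegral.integral_sub (ii _ _) (by simp), intervalIntegral.integral_const,
        e1, Real.norm_eq_abs, add_sub_cancel_left, smul_eq_mul,
        abs_of_pos (by positivity : (0:ℝ) < 1 / N)] at e2
      rw [Finset.sum_range_succ, e1,
        ← intervalIntegral.integral_add_adjacent_intervals (ii 0 (n / N)) (ii (n / N) _)]
      refine le_trans (le_of_eq ?_) (((abs_add_le _ _).trans (add_le_add ih e2)).trans
        (le_of_eq ?_))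
      · congr 1
        ring
      · ring
  have := key N le_rfl
  rwa [div_self hN'.ne', mul_one] at this

open Filter Topology in
lemma tendsto_riemann_of_tendstoUniformlyOn {F : ℕ → ℝ → ℝ} {f : ℝ → ℝ} (hf : Continuous f)
    (hF : TendstoUniformlyOn F f atTop (Icc 0 1)) {N : ℕ → ℕ} (hN : Tendsto N atTop atTop) :
    Tendsto (fun n => (1 / N n : ℝ) * ∑ j ∈ Finset.range (N n), F n (j / N n)) atTop
      (𝓝 (∫ y in (0:ℝ)..1, f y)) := by
  rw [Metric.tendsto_nhds]
  intro ε hε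
  have huc := isCompact_Icc.uniformContinuousOn_of_continuous (hf.continuousOn (s := Icc (0:ℝ) 1))
  rw [Metric.uniformContinuousOn_iff] at huc
  obtain ⟨δ, hδ, huc⟩ := huc (ε / 3) (by positivity)
  have hinv : ∀ᶠ n in atTop, (1:ℝ) / N n < δ := by
    have : Tendsto (fun n => (1:ℝ) / (N n : ℝ)) atTop (𝓝 0) :=
      tendsto_const_nhds.div_atTop (tendsto_natCast_atTop_atTop.comp hN)
    exact this.eventually (gt_mem_nhds hδ)
  filter_upwards [hinv, Metric.tendstoUniformlyOn_iff.1 hF (ε / 3) (by positivity),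
    hN.eventually_gt_atTop 0] with n h1 h2 h3
  have hN' : (0:ℝ) < N n := by exact_mod_cast h3
  have r1 := abs_integral_sub_riemann_le hf h3 (ε := ε / 3) (fun x hx y hy hxy =>
    (huc x hx y hy (by rw [Real.dist_eq]; linarith)).le)
  have r2 : |(1 / N n : ℝ) * ∑ j ∈ Finset.range (N n), F n (j / N n)
      - (1 / N n : ℝ) * ∑ j ∈ Finset.range (N n), f (j / N n)| ≤ ε / 3 := by
    rw [← mul_sub, ← Finset.sum_sub_distrib, abs_mul, abs_of_pos (by positivity)]
    have : |∑ j ∈ Finset.range (N n), (F n (j / N n) - f (j / N n))| ≤ N n * (ε / 3) := by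
      refine (Finset.abs_sum_le_sum_abs _ _).trans ?_
      refine (Finset.sum_le_card_nsmul _ _ (ε / 3) fun j hj => ?_).trans (by simp)
      have := h2 (j / N n) (natCast_div_mem_Icc (Finset.mem_range.1 hj).le)
      rw [dist_comm, Real.dist_eq] at this
      exact this.le
    calc _ ≤ 1 / (N n : ℝ) * (N n * (ε / 3)) := by gcongr
      _ = ε / 3 := by field_simp
  rw [Real.dist_eq]
  have t1 := abs_le.1 r1
  have t2 := abs_le.1 r2
  rw [abs_lt]
  constructor <;> linarith

/-- `g` solves the Nyström discretization of `μ g = ∫ K g` with mesh `1/N` and has discrete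
norm one. -/
def IsNystromPair (N : ℕ) (μ : ℝ) (g : ℝ → ℝ) : Prop :=
  (∀ x ∈ Icc (0:ℝ) 1,
    μ * g x = (1 / N : ℝ) * ∑ j ∈ Finset.range N, Kgreen x (j / N) * g (j / N)) ∧
  (1 / N : ℝ) * ∑ j ∈ Finset.range N, g (j / N) ^ 2 = 1

namespace IsNystromPair

variable {N : ℕ} {μ t : ℝ} {g : ℝ → ℝ}

lemma pos (h : IsNystromPair N μ g) : 0 < N := by
  rcases Nat.eq_zero_or_pos N with rfl | h0
  · simpa using h.2
  · exact h0

lemma abs_sum_le (h : IsNystromPair N μ g) {c : ℕ → ℝ} {B : ℝ} (hB : 0 ≤ B)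
    (hc : ∀ j < N, |c j| ≤ B) :
    |(1 / N : ℝ) * ∑ j ∈ Finset.range N, c j * g (j / N)| ≤ B := by
  have hN' : (0:ℝ) < N := by exact_mod_cast h.pos
  rw [abs_mul, abs_of_pos (by positivity)]
  have h1 : |∑ j ∈ Finset.range N, c j * g (j / N)|
      ≤ ∑ j ∈ Finset.range N, B * ((1 + g (j / N) ^ 2) / 2) := by
    refine (Finset.abs_sum_le_sum_abs _ _).trans (Finset.sum_le_sum fun j hj => ?_)
    rw [abs_mul]
    refine mul_le_mul (hc j (Finset.mem_range.1 hj)) ?_ (abs_nonneg _) hB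
    nlinarith [sq_nonneg (|g (j / N)| - 1), sq_abs (g (j / N))]
  have h2 : (1 / N : ℝ) * ∑ j ∈ Finset.range N, B * ((1 + g (j / N) ^ 2) / 2) = B := by
    rw [← Finset.mul_sum, ← Finset.sum_div, Finset.sum_add_distrib]
    have h3 := h.2
    simp only [Finset.sum_const, Finset.card_range, nsmul_eq_mul, mul_one]
    calc (1 / N : ℝ) * (B * ((N + ∑ j ∈ Finset.range N, g (j / N) ^ 2) / 2))
        = B / 2 * (1 + (1 / N : ℝ) * ∑ j ∈ Finset.range N, g (j / N) ^ 2) := by field_simp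
      _ = B := by rw [h3]; ring
  rw [← h2]
  gcongr

lemma mul_abs_sub_le (h : IsNystromPair N μ g) {x y : ℝ} (hx : x ∈ Icc (0:ℝ) 1)
    (hy : y ∈ Icc (0:ℝ) 1) : |μ * (g x - g y)| ≤ 2 * |x - y| := by
  rw [mul_sub, h.1 x hx, h.1 y hy, ← mul_sub, ← Finset.sum_sub_distrib]
  simp only [← sub_mul]
  exact h.abs_sum_le (by positivity)
    (fun j hj => abs_Kgreen_sub_le hx hy (natCast_div_mem_Icc hj.le))

lemma mul_abs_le (h : IsNystromPair N μ g) {x : ℝ} (hx : x ∈ Icc (0:ℝ) 1) : |μ * g x| ≤ 2 := by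
  rw [h.1 x hx]
  exact h.abs_sum_le (by positivity) (fun j hj => abs_Kgreen_le hx (natCast_div_mem_Icc hj.le))

lemma abs_sub_le (h : IsNystromPair N μ g) (ht : 0 < t) (hμ : t ≤ μ) {x y : ℝ}
    (hx : x ∈ Icc (0:ℝ) 1) (hy : y ∈ Icc (0:ℝ) 1) : |g x - g y| ≤ 2 / t * |x - y| := by
  have h1 := h.mul_abs_sub_le hx hy
  rw [abs_mul, abs_of_pos (ht.trans_le hμ)] at h1
  rw [div_mul_eq_mul_div, le_div_iff₀ ht]
  nlinarith [abs_nonneg (g x - g y)]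

lemma abs_le (h : IsNystromPair N μ g) (ht : 0 < t) (hμ : t ≤ μ) {x : ℝ}
    (hx : x ∈ Icc (0:ℝ) 1) : |g x| ≤ 2 / t := by
  have h1 := h.mul_abs_le hx
  rw [abs_mul, abs_of_pos (ht.trans_le hμ)] at h1
  rw [le_div_iff₀ ht]
  nlinarith [abs_nonneg (g x)]

lemma le_two (h : IsNystromPair N μ g) : μ ≤ 2 := by
  have hN' : (0:ℝ) < N := by exact_mod_cast h.pos
  have h1 : (1 / N : ℝ) * ∑ j ∈ Finset.range N, (μ * g (j / N)) ^ 2 ≤ 4 := by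
    have : ∑ j ∈ Finset.range N, (μ * g (j / N)) ^ 2 ≤ N * 4 := by
      refine (Finset.sum_le_card_nsmul _ _ 4 fun j hj => ?_).trans (by simp)
      have := h.mul_abs_le (natCast_div_mem_Icc (Finset.mem_range.1 hj).le)
      rw [← sq_abs]
      nlinarith [abs_nonneg (μ * g (j / N))]
    calc _ ≤ (1 / N : ℝ) * (N * 4) := by gcongr
      _ = 4 := by field_simp
  simp only [mul_pow] at h1
  rw [← Finset.mul_sum, mul_left_comm, h.2] at h1
  nlinarith

open Filter Topology in
/-- Collective compactness of the Nyström discretizations. -/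
lemma exists_subseq_tendsto {N : ℕ → ℕ} {μ : ℕ → ℝ} {g : ℕ → ℝ → ℝ}
    (h : ∀ n, IsNystromPair (N n) (μ n) (g n)) (ht : 0 < t) (hμ : ∀ n, t ≤ μ n)
    (hN : Tendsto N atTop atTop) :
    ∃ ψ : ℕ → ℕ, StrictMono ψ ∧ ∃ (m : ℝ) (u : ℝ → ℝ), t ≤ m ∧ Continuous u ∧
      Tendsto (fun n => μ (ψ n)) atTop (𝓝 m) ∧
      TendstoUniformlyOn (fun n => g (ψ n)) u atTop (Icc 0 1) ∧
      (∀ x ∈ Icc (0:ℝ) 1, |u x| ≤ 2 / t) ∧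
      (∀ x ∈ Icc (0:ℝ) 1, m * u x = ∫ y in (0:ℝ)..1, Kgreen x y * u y) ∧
      ∫ y in (0:ℝ)..1, u y ^ 2 = 1 := by
  have hlip : ∀ n, LipschitzWith (2 / t).toNNReal (fun x : Icc (0:ℝ) 1 => g n x) := fun n =>
    LipschitzWith.of_dist_le_mul fun x y => by
      rw [Real.dist_eq, Subtype.dist_eq, Real.dist_eq, Real.coe_toNNReal _ (by positivity)]
      exact (h n).abs_sub_le ht (hμ n) x.2 y.2
  set f : ℕ → BoundedContinuousFunction (Icc (0:ℝ) 1) ℝ := fun n =>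
    BoundedContinuousFunction.mkOfCompact ⟨fun x => g n x, (hlip n).continuous⟩ with hf
  have hcomp : IsCompact (closure (range f)) := by
    refine BoundedContinuousFunction.arzela_ascoli (Icc (-(2 / t)) (2 / t)) isCompact_Icc _ ?_ ?_
    · rintro _ x ⟨n, rfl⟩
      exact _root_.abs_le.1 ((h n).abs_le ht (hμ n) x.2)
    · refine (LipschitzWith.uniformEquicontinuous _ (2 / t).toNNReal ?_).equicontinuous
      rintro ⟨_, n, rfl⟩
      exact hlip n
  obtain ⟨U, -, ψ₁, hψ₁, hU⟩ := hcomp.tendsto_subseq (x := f)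
    (fun n => subset_closure (mem_range_self n))
  obtain ⟨m, hm, ψ₂, hψ₂, hmlim⟩ := (isCompact_Icc (a := t) (b := 2)).tendsto_subseq
    (x := fun n => μ (ψ₁ n)) (fun n => ⟨hμ _, (h _).le_two⟩)
  set u : ℝ → ℝ := fun x => U (projIcc 0 1 zero_le_one x) with hu
  have huc : Continuous u := U.continuous.comp continuous_projIcc
  have huU : ∀ x (hx : x ∈ Icc (0:ℝ) 1), u x = U ⟨x, hx⟩ := fun x hx => by
    rw [hu]
    simp only
    rw [projIcc_of_mem]
  have hunif : TendstoUniformlyOn (fun n => g (ψ₁ (ψ₂ n))) u atTop (Icc 0 1) := by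
    have h1 := BoundedContinuousFunction.tendsto_iff_tendstoUniformly.1
      (hU.comp hψ₂.tendsto_atTop)
    rw [Metric.tendstoUniformly_iff] at h1
    rw [Metric.tendstoUniformlyOn_iff]
    intro ε hε
    filter_upwards [h1 ε hε] with n hn x hx
    rw [huU x hx]
    exact hn ⟨x, hx⟩
  have hψ : StrictMono fun n => ψ₁ (ψ₂ n) := hψ₁.comp hψ₂
  have hN' : Tendsto (fun n => N (ψ₁ (ψ₂ n))) atTop atTop := hN.comp hψ.tendsto_atTop
  have hptw : ∀ x ∈ Icc (0:ℝ) 1, Tendsto (fun n => g (ψ₁ (ψ₂ n)) x) atTop (𝓝 (u x)) :=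
    fun x hx => hunif.tendsto_at hx
  have hub : ∀ x ∈ Icc (0:ℝ) 1, |u x| ≤ 2 / t := fun x hx =>
    le_of_tendsto (hptw x hx).abs (Eventually.of_forall fun n => (h _).abs_le ht (hμ _) hx)
  refine ⟨fun n => ψ₁ (ψ₂ n), hψ, m, u, hm.1, huc, hmlim, hunif, hub, fun x hx => ?_, ?_⟩
  · have hK : Continuous fun y => Kgreen x y :=
      continuous_Kgreen.comp (by fun_prop : Continuous fun y : ℝ => (x, y))
    have hconst : TendstoUniformlyOn (fun _ : ℕ => fun y => Kgreen x y) (fun y => Kgreen x y)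
        atTop (Icc 0 1) := by
      rw [Metric.tendstoUniformlyOn_iff]
      intro ε hε
      exact Eventually.of_forall fun n y _ => by rwa [dist_self]
    have h1 := tendsto_riemann_of_tendstoUniformlyOn (hK.mul huc)
      (hconst.real_mul_of_bounded (M := 2 + 2 / t) hunif
        (fun n y hy => (abs_Kgreen_le hx hy).trans (by linarith [show 0 < 2 / t by positivity]))
        (fun y hy => (hub y hy).trans (by linarith))) hN'
    have h2 : Tendsto (fun n => μ (ψ₁ (ψ₂ n)) * g (ψ₁ (ψ₂ n)) x) atTop (𝓝 (m * u x)) :=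
      hmlim.mul (hptw x hx)
    refine tendsto_nhds_unique h2 (h1.congr fun n => ?_)
    exact ((h _).1 x hx).symm
  · have h1 := tendsto_riemann_of_tendstoUniformlyOn (huc.mul huc)
      (hunif.real_mul_of_bounded hunif (fun n y hy => (h _).abs_le ht (hμ _) hy) hub) hN'
    have h2 : (fun n => (1 / N (ψ₁ (ψ₂ n)) : ℝ) * ∑ j ∈ Finset.range (N (ψ₁ (ψ₂ n))),
        g (ψ₁ (ψ₂ n)) (j / N (ψ₁ (ψ₂ n))) * g (ψ₁ (ψ₂ n)) (j / N (ψ₁ (ψ₂ n)))) = fun _ => 1 := by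
      funext n
      have := (h (ψ₁ (ψ₂ n))).2
      simp only [sq] at this
      exact this
    rw [h2] at h1
    simp only [sq]
    exact tendsto_nhds_unique h1 tendsto_const_nhds

end IsNystromPair

/-- The discrete eigenvalue error on finitely many grids is bounded by a multiple of `h⁴`. -/
lemma exists_bound_of_finite_range {lam : ℝ} (hlam : 0 < lam) (k n₀ : ℕ) :
    ∃ C ≥ (0:ℝ), ∀ N : ℕ, k + 1 ≤ N → N < n₀ → ∀ (hsym : (Kmat N).IsHermitian) (j : Fin (N - 1)),
      |lam - (hsym.eigenvalues j)⁻¹| ≤ C * ((1:ℝ) / N) ^ 4 := by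
  classical
  set M : ℕ → ℝ := fun N => if h : (Kmat N).IsHermitian then
    (N:ℝ) ^ 4 * (lam + ∑ j, |(h.eigenvalues j)⁻¹|) else 0 with hM
  have hM0 : ∀ N, 0 ≤ M N := by
    intro N
    simp only [hM]
    split_ifs
    · positivity
    · rfl
  refine ⟨∑ N ∈ Finset.range n₀, M N, Finset.sum_nonneg fun N _ => hM0 N, ?_⟩
  intro N hkN hN hsym j
  have hN' : (0:ℝ) < N := by
    have : 0 < N := by omega
    exact_mod_cast this
  have h1 : M N ≤ ∑ N ∈ Finset.range n₀, M N :=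
    Finset.single_le_sum (fun N _ => hM0 N) (Finset.mem_range.2 hN)
  have h2 : |(hsym.eigenvalues j)⁻¹| ≤ ∑ j, |(hsym.eigenvalues j)⁻¹| :=
    Finset.single_le_sum (f := fun j => |(hsym.eigenvalues j)⁻¹|) (fun j _ => abs_nonneg _)
      (Finset.mem_univ j)
  have h3 : M N * ((1:ℝ) / N) ^ 4 = lam + ∑ j, |(hsym.eigenvalues j)⁻¹| := by
    simp only [hM]
    rw [dif_pos hsym]
    field_simp
  calc |lam - (hsym.eigenvalues j)⁻¹| ≤ |lam| + |(hsym.eigenvalues j)⁻¹| := abs_sub _ _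
    _ ≤ M N * ((1:ℝ) / N) ^ 4 := by
        rw [h3, abs_of_pos hlam]
        linarith
    _ ≤ _ := by gcongr

/-- A real symmetric matrix has an eigenvalue within the relative residual of any trial pair. -/
lemma Matrix.IsHermitian.exists_eigenvalue_near {n : Type*} [Fintype n] [DecidableEq n]
    {A : Matrix n n ℝ} (hA : A.IsHermitian) {w : n → ℝ} {θ δ : ℝ} (hδ : 0 ≤ δ)
    (hw : 0 < ∑ i, w i ^ 2)
    (h : ∑ i, (A.mulVec w i - θ * w i) ^ 2 ≤ δ ^ 2 * ∑ i, w i ^ 2) :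
    ∃ j, |hA.eigenvalues j - θ| ≤ δ := by
  by_contra! hcon
  set b := hA.eigenvectorBasis with hb
  set x : EuclideanSpace ℝ n := WithLp.toLp 2 w with hx
  set y : EuclideanSpace ℝ n := WithLp.toLp 2 (fun i => A.mulVec w i - θ * w i) with hy
  have hxn : ‖x‖ ^ 2 = ∑ i, w i ^ 2 := EuclideanSpace.real_norm_sq_eq x
  have hyn : ‖y‖ ^ 2 = ∑ i, (A.mulVec w i - θ * w i) ^ 2 := EuclideanSpace.real_norm_sq_eq y
  have hsymm : A.transpose = A := by
    have := hA.eq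
    rwa [Matrix.conjTranspose_eq_transpose_of_trivial] at this
  have hin : ∀ j, inner ℝ (b j) y = (hA.eigenvalues j - θ) * inner ℝ (b j) x := by
    intro j
    have e0 : ∀ z : n → ℝ, inner ℝ (b j) (WithLp.toLp 2 z : EuclideanSpace ℝ n)
        = dotProduct z (b j).ofLp := by
      intro z
      rw [EuclideanSpace.inner_eq_star_dotProduct, star_trivial]
    have e1 : dotProduct (A.mulVec w) (b j).ofLp = hA.eigenvalues j * dotProduct w (b j).ofLp := by
      rw [dotProduct_comm, Matrix.dotProduct_mulVec, ← Matrix.mulVec_transpose, hsymm,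
        hb, hA.mulVec_eigenvectorBasis, smul_dotProduct, smul_eq_mul, dotProduct_comm]
    have e2 : (fun i => A.mulVec w i - θ * w i) = A.mulVec w - θ • w := by
      ext i
      simp
    rw [hx, hy, e0, e0, e2, sub_dotProduct, smul_dotProduct, e1, smul_eq_mul]
    ring
  have hpx := b.sum_sq_norm_inner_right x
  have hpy := b.sum_sq_norm_inner_right y
  have hlt : ∑ j, δ ^ 2 * ‖inner ℝ (b j) x‖ ^ 2 < ∑ j, ‖inner ℝ (b j) y‖ ^ 2 := by
    have hsq : ∀ j, δ ^ 2 < (hA.eigenvalues j - θ) ^ 2 := fun j => by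
      rw [← sq_abs (hA.eigenvalues j - θ)]
      exact pow_lt_pow_left₀ (hcon j) hδ two_ne_zero
    have hterm : ∀ j, ‖inner ℝ (b j) y‖ ^ 2
        = (hA.eigenvalues j - θ) ^ 2 * ‖inner ℝ (b j) x‖ ^ 2 := fun j => by
      rw [hin, norm_mul, mul_pow, Real.norm_eq_abs, sq_abs]
    refine Finset.sum_lt_sum (fun j _ => ?_) ?_
    · rw [hterm]
      exact mul_le_mul_of_nonneg_right (hsq j).le (by positivity)
    · rw [← hxn, ← hpx] at hw
      obtain ⟨j, hj, hjpos⟩ := Finset.exists_lt_of_sum_lt (f := fun _ => (0:ℝ))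
        (Finset.sum_const_zero.trans_lt hw)
      exact ⟨j, hj, by rw [hterm]; exact mul_lt_mul_of_pos_right (hsq j) hjpos⟩
  rw [← Finset.mul_sum, hpx, hpy, hxn, hyn] at hlt
  linarith

lemma sum_range_div_eq {N : ℕ} (hN : 0 < N) (f : ℝ → ℝ) :
    ∑ j ∈ Finset.range N, f (j / N) = f 0 + ∑ i : Fin (N - 1), f (((i : ℕ) + 1 : ℝ) / N) := by
  obtain ⟨n, rfl⟩ : ∃ n, N = n + 1 := ⟨N - 1, by omega⟩
  rw [Finset.sum_range_succ', add_comm, Nat.add_sub_cancel, Finset.sum_range]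
  simp

lemma grid_mem_Icc {N : ℕ} (i : Fin (N - 1)) : ((i : ℕ) + 1 : ℝ) / N ∈ Icc (0:ℝ) 1 := by
  have h := natCast_div_mem_Icc (j := (i : ℕ) + 1) (N := N) (by omega)
  push_cast at h
  exact h

open Filter Topology in
/-- Every eigenvalue of the clamped problem is approximated to fourth order. -/
lemma IsClampedBiharmonicEV.exists_eigenvalue_near {lam : ℝ} (hlam : 0 < lam)
    (h : IsClampedBiharmonicEV lam) :
    ∃ C > (0:ℝ), ∃ n₀ : ℕ, ∀ N ≥ n₀, ∀ hsym : (Kmat N).IsHermitian,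
      ∃ j, |hsym.eigenvalues j - lam⁻¹| ≤ C * ((1:ℝ) / N) ^ 4 := by
  obtain ⟨φ, hφ, ⟨x₀, hx₀, hne⟩, hode, a0, a1, b0, b1⟩ := h
  obtain ⟨C, hC, hres⟩ := clampedBiharmonic_nystrom_consistency hlam.ne' hφ hode a0 a1 b0 b1
  have hφ2 : Continuous fun x => φ x ^ 2 := hφ.continuous.pow 2
  have hIpos : 0 < ∫ y in (0:ℝ)..1, φ y ^ 2 :=
    intervalIntegral.integral_pos zero_lt_one hφ2.continuousOn (fun x _ => sq_nonneg _)
      ⟨x₀, hx₀, by positivity⟩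
  set I : ℝ := ∫ y in (0:ℝ)..1, φ y ^ 2 with hI
  have hlim : Tendsto (fun N : ℕ => (1 / N : ℝ) * ∑ j ∈ Finset.range N, φ (j / N) ^ 2) atTop
      (𝓝 I) := tendsto_riemann_of_tendstoUniformlyOn (F := fun _ x => φ x ^ 2) hφ2 (by
        rw [Metric.tendstoUniformlyOn_iff]
        intro ε hε
        exact Eventually.of_forall fun n y _ => by rwa [dist_self]) tendsto_id
  obtain ⟨n₀, hn₀⟩ := eventually_atTop.1
    ((hlim.eventually (lt_mem_nhds (half_lt_self hIpos))).and (eventually_gt_atTop 0))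
  have hs : 0 < √(I / 2) := Real.sqrt_pos.2 (by positivity)
  refine ⟨C / √(I / 2), by positivity, n₀, fun N hN hsym => ?_⟩
  obtain ⟨hsum, hNpos⟩ := hn₀ N hN
  have hN' : (0:ℝ) < N := by exact_mod_cast hNpos
  rw [sum_range_div_eq hNpos (fun x => φ x ^ 2), a0] at hsum
  have hsum' : (N:ℝ) * (I / 2) < ∑ i : Fin (N - 1), φ (((i : ℕ) + 1 : ℝ) / N) ^ 2 := by
    calc (N:ℝ) * (I / 2) < N * ((1 / N : ℝ) * (0 ^ 2
          + ∑ i : Fin (N - 1), φ (((i : ℕ) + 1 : ℝ) / N) ^ 2)) := by gcongr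
      _ = _ := by
        field_simp
        ring
  refine hsym.exists_eigenvalue_near (w := fun i => φ (((i : ℕ) + 1 : ℝ) / N)) (by positivity)
    (lt_trans (by positivity) hsum') ?_
  have hterm : ∀ i : Fin (N - 1), ((Kmat N).mulVec (fun i => φ (((i : ℕ) + 1 : ℝ) / N)) i
      - lam⁻¹ * φ (((i : ℕ) + 1 : ℝ) / N)) ^ 2 ≤ (C * (1 / N : ℝ) ^ 4) ^ 2 := by
    intro i
    have h1 := hres N hNpos ((i : ℕ) + 1) (by omega)
    push_cast at h1
    rw [sum_range_div_eq hNpos (fun y => Kgreen (((i : ℕ) + 1 : ℝ) / N) y * φ y), a0] at h1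
    have h2 : (Kmat N).mulVec (fun i => φ (((i : ℕ) + 1 : ℝ) / N)) i
        = (1 / N : ℝ) * (Kgreen (((i : ℕ) + 1 : ℝ) / N) 0 * 0 + ∑ j : Fin (N - 1),
          Kgreen (((i : ℕ) + 1 : ℝ) / N) (((j : ℕ) + 1 : ℝ) / N)
            * φ (((j : ℕ) + 1 : ℝ) / N)) := by
      simp only [Matrix.mulVec, dotProduct, Kmat, mul_zero, zero_add, Finset.mul_sum, mul_assoc]
    rw [h2, ← sq_abs, ← div_eq_inv_mul]
    exact pow_le_pow_left₀ (abs_nonneg _) h1 2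
  calc _ ≤ ∑ _i : Fin (N - 1), (C * (1 / N : ℝ) ^ 4) ^ 2 := Finset.sum_le_sum fun i _ => hterm i
    _ = ((N - 1 : ℕ) : ℝ) * (C * (1 / N : ℝ) ^ 4) ^ 2 := by simp
    _ ≤ N * (C * (1 / N : ℝ) ^ 4) ^ 2 := by
        gcongr
        omega
    _ = (C / √(I / 2) * (1 / N : ℝ) ^ 4) ^ 2 * (N * (I / 2)) := by
        have hsq : (C / √(I / 2)) ^ 2 = C ^ 2 / (I / 2) := by
          rw [div_pow, Real.sq_sqrt (by positivity)]
        rw [mul_pow (C / √(I / 2)), hsq]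
        field_simp
    _ ≤ _ := by gcongr

/-- The eigenvectors of `Kmat N` extend to orthogonal Nyström pairs. -/
lemma exists_isNystromPair {N : ℕ} (hsym : (Kmat N).IsHermitian) :
    ∃ g : Fin (N - 1) → ℝ → ℝ, (∀ j, hsym.eigenvalues j ≠ 0 →
      IsNystromPair N (hsym.eigenvalues j) (g j)) ∧
      ∀ j j', j ≠ j' → hsym.eigenvalues j ≠ 0 → hsym.eigenvalues j' ≠ 0 →
        (1 / N : ℝ) * ∑ i ∈ Finset.range N, g j (i / N) * g j' (i / N) = 0 := by
  set v : Fin (N - 1) → Fin (N - 1) → ℝ := fun j i => √N * (hsym.eigenvectorBasis j).ofLp i with hv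
  set g : Fin (N - 1) → ℝ → ℝ := fun j x => (hsym.eigenvalues j)⁻¹ *
    ((1 / N : ℝ) * ∑ i : Fin (N - 1), Kgreen x (((i : ℕ) + 1 : ℝ) / N) * v j i) with hg
  have g0 : ∀ j, g j 0 = 0 := fun j => by
    have h0 : ∑ i : Fin (N - 1), Kgreen 0 (((i : ℕ) + 1 : ℝ) / N) * v j i = 0 :=
      Finset.sum_eq_zero fun i _ => by rw [Kgreen_zero_left (grid_mem_Icc i).1, zero_mul]
    simp [hg, h0]
  have gv : ∀ j, hsym.eigenvalues j ≠ 0 → ∀ i : Fin (N - 1),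
      g j (((i : ℕ) + 1 : ℝ) / N) = v j i := by
    intro j hj i
    have h1 := congrFun (hsym.mulVec_eigenvectorBasis j) i
    have h2 : (1 / N : ℝ) * ∑ l : Fin (N - 1),
        Kgreen (((i : ℕ) + 1 : ℝ) / N) (((l : ℕ) + 1 : ℝ) / N) * v j l
        = √N * (Kmat N).mulVec (hsym.eigenvectorBasis j).ofLp i := by
      simp only [Matrix.mulVec, dotProduct, Kmat, Finset.mul_sum, hv]
      exact Finset.sum_congr rfl fun l _ => by ring
    simp only [hg]
    rw [h2, h1, Pi.smul_apply, smul_eq_mul, hv]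
    field_simp
  have hdot : ∀ j j', (1 / N : ℝ) * ∑ i, v j i * v j' i
      = (1 / N : ℝ) * N * inner ℝ (hsym.eigenvectorBasis j) (hsym.eigenvectorBasis j') := by
    intro j j'
    rw [EuclideanSpace.inner_eq_star_dotProduct, star_trivial, dotProduct, Finset.mul_sum,
      Finset.mul_sum]
    refine Finset.sum_congr rfl fun i _ => ?_
    simp only [hv]
    linear_combination (1 / N : ℝ) * ((hsym.eigenvectorBasis j).ofLp i * (hsym.eigenvectorBasis j').ofLp i)
      * Real.mul_self_sqrt (Nat.cast_nonneg (α := ℝ) N)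
  have hprod : ∀ j j', hsym.eigenvalues j ≠ 0 → hsym.eigenvalues j' ≠ 0 → 0 < N →
      (1 / N : ℝ) * ∑ i ∈ Finset.range N, g j (i / N) * g j' (i / N)
        = inner ℝ (hsym.eigenvectorBasis j) (hsym.eigenvectorBasis j') := by
    intro j j' hj hj' hN
    have hN' : (N:ℝ) ≠ 0 := by exact_mod_cast hN.ne'
    rw [sum_range_div_eq hN (fun x => g j x * g j' x), g0, zero_mul, zero_add]
    simp only [gv j hj, gv j' hj']
    rw [hdot, one_div_mul_cancel hN', one_mul]
  refine ⟨g, fun j hj => ⟨fun x hx => ?_, ?_⟩, fun j j' hjj' hj hj' => ?_⟩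
  · have hN : 0 < N := by have := j.2; omega
    rw [sum_range_div_eq hN (fun y => Kgreen x y * g j y), g0, mul_zero, zero_add]
    simp only [gv j hj]
    simp only [hg]
    rw [mul_inv_cancel_left₀ hj]
  · have hN : 0 < N := by have := j.2; omega
    simp only [sq]
    rw [hprod j j hj hj hN, real_inner_self_eq_norm_sq, hsym.eigenvectorBasis.norm_eq_one]
    norm_num
  · have hN : 0 < N := by have := j.2; omega
    rw [hprod j j' hj hj' hN]
    exact hsym.eigenvectorBasis.orthonormal.2 hjj'

open Filter Topology in
/-- Discrete eigenvalues bounded away from zero cluster only at continuous ones. -/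
lemma exists_clampedBiharmonicEV_near {t ε : ℝ} (ht : 0 < t) (hε : 0 < ε) :
    ∃ n₀ : ℕ, ∀ N ≥ n₀, ∀ (hsym : (Kmat N).IsHermitian) (j : Fin (N - 1)),
      t ≤ hsym.eigenvalues j →
        ∃ lam, IsClampedBiharmonicEV lam ∧ |hsym.eigenvalues j - lam⁻¹| < ε := by
  by_contra! hcon
  choose N hN hsym j hj hfar using hcon
  choose g hg _ using fun n => exists_isNystromPair (hsym n)
  obtain ⟨ψ, -, m, u, htm, hu, hμ, -, -, heq, hnorm⟩ := IsNystromPair.exists_subseq_tendsto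
    (fun n => hg n (j n) (ht.trans_le (hj n)).ne') ht hj (tendsto_atTop_mono hN tendsto_id)
  have hEV : IsClampedBiharmonicEV m⁻¹ := by
    refine isClampedBiharmonicEV_of_integral_eq (ht.trans_le htm).ne' hu heq ?_
    by_contra! hz
    rw [intervalIntegral.integral_congr (g := fun _ => (0:ℝ)), intervalIntegral.integral_zero]
      at hnorm
    · exact zero_ne_one hnorm
    · intro y hy
      rw [uIcc_of_le zero_le_one] at hy
      simp [hz y hy]
  obtain ⟨n, hn⟩ := ((Metric.tendsto_nhds.1 hμ) ε hε).exists
  have := hfar (ψ n) m⁻¹ hEV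
  rw [inv_inv] at this
  rw [Real.dist_eq] at hn
  linarith

open Filter Topology in
/-- Distinct discrete eigenvalues cannot cluster at the same point. -/
lemma exists_eigenvalues_separated {m : ℝ} (hm : 0 < m) :
    ∃ δ > (0:ℝ), ∃ n₀ : ℕ, ∀ N ≥ n₀, ∀ (hsym : (Kmat N).IsHermitian) (j j' : Fin (N - 1)),
      |hsym.eigenvalues j - m| < δ → |hsym.eigenvalues j' - m| < δ → j = j' := by
  by_contra! hcon
  have hδ : ∀ n : ℕ, 0 < m / 2 * (1 / ((n:ℝ) + 1)) := fun n => by positivity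
  choose N hN hsym j j' hj hj' hne using fun n : ℕ => hcon _ (hδ n) n
  have hδle : ∀ n : ℕ, m / 2 * (1 / ((n:ℝ) + 1)) ≤ m / 2 := fun n => by
    refine mul_le_of_le_one_right (by positivity) (div_le_one_of_le₀ ?_ (by positivity))
    linarith [(Nat.cast_nonneg n : (0:ℝ) ≤ n)]
  have hδlim : Tendsto (fun n : ℕ => m / 2 * (1 / ((n:ℝ) + 1))) atTop (𝓝 0) := by
    simpa using tendsto_one_div_add_atTop_nhds_zero_nat.const_mul (m / 2)
  have ht : 0 < m / 2 := by positivity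
  have hlow : ∀ n, m / 2 ≤ (hsym n).eigenvalues (j n) := fun n => by
    linarith [(abs_lt.1 (hj n)).1, hδle n]
  have hlow' : ∀ n, m / 2 ≤ (hsym n).eigenvalues (j' n) := fun n => by
    linarith [(abs_lt.1 (hj' n)).1, hδle n]
  have hlim : Tendsto (fun n => (hsym n).eigenvalues (j n)) atTop (𝓝 m) := by
    rw [tendsto_iff_dist_tendsto_zero]
    exact squeeze_zero (fun n => dist_nonneg) (fun n => (hj n).le) hδlim
  have hlim' : Tendsto (fun n => (hsym n).eigenvalues (j' n)) atTop (𝓝 m) := by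
    rw [tendsto_iff_dist_tendsto_zero]
    exact squeeze_zero (fun n => dist_nonneg) (fun n => (hj' n).le) hδlim
  choose g hg horth using fun n => exists_isNystromPair (hsym n)
  have hNlim : Tendsto N atTop atTop := tendsto_atTop_mono hN tendsto_id
  have hP := fun n => hg n (j n) (ht.trans_le (hlow n)).ne'
  have hP' := fun n => hg n (j' n) (ht.trans_le (hlow' n)).ne'
  obtain ⟨ψ, hψ, m₁, u, -, hu, hμ, hunif, -, hequ, hu1⟩ :=
    IsNystromPair.exists_subseq_tendsto hP ht hlow hNlim
  obtain ⟨χ, hχ, m₂, w, -, hw, hμ', hunif', hwb, heqw, hw1⟩ :=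
    IsNystromPair.exists_subseq_tendsto (fun n => hP' (ψ n)) ht (fun n => hlow' (ψ n))
      (hNlim.comp hψ.tendsto_atTop)
  have e1 : m₁ = m := tendsto_nhds_unique hμ (hlim.comp hψ.tendsto_atTop)
  have e2 : m₂ = m := tendsto_nhds_unique hμ'
    (hlim'.comp (hψ.tendsto_atTop.comp hχ.tendsto_atTop))
  rw [e1] at hequ
  rw [e2] at heqw
  have hunif2 : TendstoUniformlyOn (fun n => g (ψ (χ n)) (j (ψ (χ n)))) u atTop (Icc 0 1) := by
    rw [Metric.tendstoUniformlyOn_iff] at hunif ⊢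
    exact fun ε hε => hχ.tendsto_atTop.eventually (hunif ε hε)
  have hfin := tendsto_riemann_of_tendstoUniformlyOn (hu.mul hw)
    (hunif2.real_mul_of_bounded hunif' (fun n y hy => (hP _).abs_le ht (hlow _) hy) hwb)
    (hNlim.comp (hψ.tendsto_atTop.comp hχ.tendsto_atTop))
  refine integral_eq_simple hm hu hw hequ heqw hu1 hw1
    (tendsto_nhds_unique hfin (tendsto_const_nhds.congr fun n => ?_))
  exact (horth (ψ (χ n)) (j (ψ (χ n))) (j' (ψ (χ n))) (hne _) (ht.trans_le (hlow _)).ne'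
    (ht.trans_le (hlow' _)).ne').symm

open Filter Topology in
/-- For fine grids, the `κ`-th largest eigenvalue of `Kmat N` lies near the reciprocal of the
`κ`-th continuous eigenvalue (counting from zero). -/
lemma exists_eigenvalue_error_bound {lam : ℕ → ℝ} (hmono : StrictMono lam)
    (hpos : ∀ i, 0 < lam i) (hev : ∀ i, IsClampedBiharmonicEV (lam i))
    (hall : ∀ μ : ℝ, IsClampedBiharmonicEV μ → ∃ i, μ = lam i) (κ : ℕ) :
    ∃ C > (0:ℝ), ∃ t > (0:ℝ), ∃ n₀ : ℕ, ∀ N ≥ n₀,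
      ∀ (hsym : (Kmat N).IsHermitian) (μ : Fin (N-1) → ℝ), Antitone μ →
        (∃ σ : Equiv.Perm (Fin (N-1)), ∀ i, μ i = hsym.eigenvalues (σ i)) →
        ∀ j : Fin (N - 1), (j : ℕ) = κ →
          t ≤ μ j ∧ |μ j - (lam κ)⁻¹| ≤ C * ((1:ℝ) / N) ^ 4 := by
  choose C hC nA hA using fun i => (hev i).exists_eigenvalue_near (hpos i)
  choose d hd nB hB using fun i => exists_eigenvalues_separated (inv_pos.2 (hpos i))
  have hanti : ∀ {i i'}, i < i' → (lam i')⁻¹ < (lam i)⁻¹ := fun h =>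
    inv_strictAnti₀ (hpos _) (hmono h)
  have hanti' : ∀ {i i'}, i ≤ i' → (lam i')⁻¹ ≤ (lam i)⁻¹ := fun h =>
    inv_anti₀ (hpos _) (hmono.monotone h)
  have hne : (Finset.range (κ + 1)).Nonempty := ⟨0, by simp⟩
  set δ : ℝ := (Finset.range (κ + 1)).inf' hne
    (fun i => min (d i) (((lam i)⁻¹ - (lam (i + 1))⁻¹) / 2)) with hδdef
  have hδpos : 0 < δ := (Finset.lt_inf'_iff hne).2 fun i _ =>
    lt_min (hd i) (by linarith [hanti (Nat.lt_succ_self i)])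
  have hδle : ∀ i ≤ κ, δ ≤ d i ∧ δ ≤ ((lam i)⁻¹ - (lam (i + 1))⁻¹) / 2 := fun i hi =>
    le_min_iff.1 (Finset.inf'_le _ (Finset.mem_range.2 (by omega)))
  set t : ℝ := ((lam κ)⁻¹ + (lam (κ + 1))⁻¹) / 2 with ht
  have htpos : 0 < t := by
    have h1 := inv_pos.2 (hpos κ)
    have h2 := inv_pos.2 (hpos (κ + 1))
    positivity
  obtain ⟨nC, hnC⟩ := exists_clampedBiharmonicEV_near htpos hδpos
  have hsmall : ∀ i, ∀ᶠ N : ℕ in atTop, C i * ((1:ℝ) / N) ^ 4 < δ := fun i => by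
    have h := (tendsto_one_div_atTop_nhds_zero_nat (𝕜 := ℝ)).pow 4 |>.const_mul (C i)
    rw [zero_pow (by norm_num), mul_zero] at h
    exact h.eventually (gt_mem_nhds hδpos)
  have hlarge : ∀ᶠ N : ℕ in atTop, nC ≤ N ∧ ∀ i ∈ Finset.range (κ + 1),
      nA i ≤ N ∧ nB i ≤ N ∧ C i * ((1:ℝ) / N) ^ 4 < δ :=
    (eventually_ge_atTop nC).and ((Finset.eventually_all _).2 fun i _ =>
      (eventually_ge_atTop _).and ((eventually_ge_atTop _).and (hsmall i)))
  obtain ⟨n₀, hn₀⟩ := eventually_atTop.1 hlarge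
  refine ⟨C κ, hC κ, t, htpos, n₀, fun N hN hsym μ hμ ⟨σ, hσ⟩ j hj => ?_⟩
  obtain ⟨hNC, hN'⟩ := hn₀ N hN
  have hex : ∀ i, ∃ l : Fin (N - 1), i ≤ κ → |μ l - (lam i)⁻¹| ≤ C i * ((1:ℝ) / N) ^ 4 := by
    intro i
    by_cases hi : i ≤ κ
    · obtain ⟨l, hl⟩ := hA i N (hN' i (Finset.mem_range.2 (by omega))).1 hsym
      exact ⟨σ.symm l, fun _ => by rwa [hσ, Equiv.apply_symm_apply]⟩
    · exact ⟨j, fun h => absurd h hi⟩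
  choose J hJ using hex
  have hJδ : ∀ i ≤ κ, |μ (J i) - (lam i)⁻¹| < δ := fun i hi =>
    (hJ i hi).trans_lt (hN' i (Finset.mem_range.2 (by omega))).2.2
  have hJlt : ∀ i i', i < i' → i' ≤ κ → μ (J i') < μ (J i) := fun i i' hii' hi' => by
    linarith [(abs_lt.1 (hJδ i (by omega))).1, (abs_lt.1 (hJδ i' hi')).2,
      (hδle i (by omega)).2, hanti' (Nat.succ_le_of_lt hii')]
  have htJ : t ≤ μ (J κ) := by
    linarith [(abs_lt.1 (hJδ κ le_rfl)).1, (hδle κ le_rfl).2]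
  have himage : (Finset.range (κ + 1)).image J = Finset.Iic (J κ) := by
    ext l
    rw [Finset.mem_image, Finset.mem_Iic]
    constructor
    · rintro ⟨i, hi, rfl⟩
      rcases (Nat.lt_succ_iff.1 (Finset.mem_range.1 hi)).lt_or_eq with h | rfl
      · by_contra! hlt
        exact (hJlt i κ h le_rfl).not_ge (hμ hlt.le)
      · exact le_rfl
    · intro hl
      have htl : t ≤ μ l := htJ.trans (hμ hl)
      rw [hσ] at htl
      obtain ⟨ν, hν, hclose⟩ := hnC N hNC hsym (σ l) htl
      obtain ⟨i, rfl⟩ := hall ν hν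
      have hi : i ≤ κ := by
        by_contra! hi
        linarith [(abs_lt.1 hclose).2, hanti' (Nat.succ_le_of_lt hi), (hδle κ le_rfl).2]
      refine ⟨i, Finset.mem_range.2 (by omega), σ.injective ?_⟩
      have hJi := hJδ i hi
      rw [hσ] at hJi
      exact hB i N (hN' i (Finset.mem_range.2 (by omega))).2.1 hsym _ _
        (hJi.trans_le (hδle i hi).1) (hclose.trans_le (hδle i hi).1)
  have hinj : Set.InjOn J (Finset.range (κ + 1)) := by
    intro i hi i' hi' h
    rw [Finset.coe_range, mem_Iio] at hi hi'
    by_contra hii'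
    rcases lt_or_gt_of_ne hii' with hlt | hlt
    · exact (hJlt _ _ hlt (by omega)).ne (by rw [h])
    · exact (hJlt _ _ hlt (by omega)).ne (by rw [h])
  have hcard := congrArg Finset.card himage
  rw [Finset.card_image_of_injOn hinj, Finset.card_range, Fin.card_Iic] at hcard
  obtain rfl : j = J κ := Fin.ext (by omega)
  exact ⟨htJ, hJ κ le_rfl⟩

/-- Optimal rate of convergence of the discrete eigenvalues: if `0 < λ₁ < λ₂ < ⋯`
enumerates the eigenvalues of the clamped biharmonic operator (here `lam i = λ_{i+1}`),
`k ≥ 1` is fixed, and for each `N ≥ k+1` the eigenvalues of `K^h` in decreasing order are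
`μ_1 ≥ ⋯ ≥ μ_{N-1}`, then the `k`-th discrete biharmonic eigenvalue `λ_{h,k} = 1/μ_k`
satisfies `|λ_k - λ_{h,k}| ≤ C·h⁴` with `C` depending only on `k`. -/
theorem optimal_eigenvalue_convergence_rate
    (lam : ℕ → ℝ) (hmono : StrictMono lam) (hpos : ∀ i, 0 < lam i)
    (hev : ∀ i, IsClampedBiharmonicEV (lam i))
    (hall : ∀ μ : ℝ, IsClampedBiharmonicEV μ → ∃ i, μ = lam i)
    (k : ℕ) (hk : 1 ≤ k) :
    ∃ C > (0:ℝ), ∀ N : ℕ, (hN : k + 1 ≤ N) →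
      ∀ (hsym : (Kmat N).IsHermitian) (μ : Fin (N-1) → ℝ),
        (∀ i j : Fin (N-1), i ≤ j → μ j ≤ μ i) →
        (∃ σ : Equiv.Perm (Fin (N-1)), ∀ i, μ i = hsym.eigenvalues (σ i)) →
        |lam (k-1) - (μ ⟨k-1, by omega⟩)⁻¹| ≤ C * ((1:ℝ)/N)^4 := by
  obtain ⟨C, hC, t, ht, n₀, hbound⟩ := exists_eigenvalue_error_bound hmono hpos hev hall (k - 1)
  obtain ⟨C', hC', hfin⟩ := exists_bound_of_finite_range (hpos (k - 1)) k n₀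
  have hlam := hpos (k - 1)
  refine ⟨lam (k - 1) * C / t + C', by positivity, fun N hN hsym μ hμ hσ => ?_⟩
  have hN4 : 0 ≤ ((1:ℝ) / N) ^ 4 := by positivity
  rcases lt_or_ge N n₀ with hlt | hge
  · obtain ⟨σ, hσ⟩ := hσ
    rw [hσ]
    refine (hfin N hN hlt hsym _).trans (mul_le_mul_of_nonneg_right ?_ hN4)
    exact le_add_of_nonneg_left (by positivity)
  · obtain ⟨htμ, herr⟩ := hbound N hge hsym μ (fun i j hij => hμ i j hij) hσ ⟨k - 1, by omega⟩ rfl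
    set m := μ ⟨k - 1, by omega⟩
    have hm : 0 < m := ht.trans_le htμ
    have heq : lam (k - 1) - m⁻¹ = lam (k - 1) * (m - (lam (k - 1))⁻¹) / m := by
      field_simp
    rw [heq, abs_div, abs_mul, abs_of_pos hlam, abs_of_pos hm]
    calc lam (k - 1) * |m - (lam (k - 1))⁻¹| / m
        ≤ lam (k - 1) * (C * ((1:ℝ) / N) ^ 4) / t := by gcongr
      _ = lam (k - 1) * C / t * ((1:ℝ) / N) ^ 4 := by ring
      _ ≤ _ := mul_le_mul_of_nonneg_right (le_add_of_nonneg_right hC') hN4
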